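/- Let Ω = Λ ∪ Υ (Λ, Υ disjoint) be a set of finitary operation symbols, 𝓛* a signature containing the polarity signature, and Φ = {φ_f : f ∈ Ω} with φ_f an 𝓛*_n-formula with one free variable for n-ary f. Let 𝒮 be a class of 𝓛*-structures based on polarities that is closed under ultraproducts, such that for every P ∈ 𝒮 the stable set lattice P⁺ is closed under the operation f^P_{φ_f} for every f ∈ Ω, and the restriction of f^P_{φ_f} to P⁺ is a complete normal operator when f ∈ Λ and a complete normal dual operator when f ∈ Υ. Let 𝒱 be the variety of Ω-lattices generated by {P⁺_Ω : P ∈ 𝒮}, i.e. the class of all homomorphic images of Ω-sublattices of direct products of algebras P⁺_Ω with P ∈ 𝒮. Then 𝒱 is closed under canonical extensions: if L ∈ 𝒱 and L^σ is a canonical extension of L (a dense and compact completion of the underlying bounded lattice of L, carrying the lower canonical extensions of the Λ-operations and the upper canonical extensions of the Υ-operations of L), then L^σ ∈ 𝒱. -/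

import Mathlib

open FirstOrder FirstOrder.Language FirstOrder.Language.Structure

namespace PaperCore

/-! ### Typed polarities and stable set lattices -/

section Pol
variable {X Y : Type*}

def rho (R : X → Y → Prop) (A : Set X) : Set Y := {y | ∀ x ∈ A, R x y}

def lam (R : X → Y → Prop) (B : Set Y) : Set X := {x | ∀ y ∈ B, R x y}

def IsStable (R : X → Y → Prop) (A : Set X) : Prop := lam R (rho R A) ⊆ A

def IsStableY (R : X → Y → Prop) (B : Set Y) : Prop := rho R (lam R B) ⊆ B

lemma rho_anti {R : X → Y → Prop} {A B : Set X} (h : A ⊆ B) : rho R B ⊆ rho R A :=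
  fun y hy x hx => hy x (h hx)

lemma lam_anti {R : X → Y → Prop} {B B' : Set Y} (h : B ⊆ B') : lam R B' ⊆ lam R B :=
  fun x hx y hy => hx y (h hy)

lemma lamrho_mono {R : X → Y → Prop} {A B : Set X} (h : A ⊆ B) :
    lam R (rho R A) ⊆ lam R (rho R B) := lam_anti (rho_anti h)

def Stable (R : X → Y → Prop) : Type _ := {A : Set X // IsStable R A}

namespace Stable

variable {R : X → Y → Prop}

instance : PartialOrder (Stable R) :=
  inferInstanceAs (PartialOrder {A : Set X // IsStable R A})

lemma le_def {A B : Stable R} : A ≤ B ↔ A.1 ⊆ B.1 := Iff.rfl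

instance : InfSet (Stable R) :=
  ⟨fun S => ⟨⋂ A ∈ S, A.1, fun x hx => Set.mem_iInter₂.2 fun A hA =>
    A.2 (lamrho_mono (Set.biInter_subset_of_mem hA) hx)⟩⟩

instance : CompleteLattice (Stable R) :=
  completeLatticeOfInf _ (fun S =>
    ⟨fun A hA => Set.biInter_subset_of_mem hA,
     fun B hB => Set.subset_iInter₂ fun A hA => hB hA⟩)

end Stable
end Pol

/-! ### Ultraproducts of indexed families (as plain quotients) -/

section UProd
variable {I : Type*}

def uSetoid (U : Ultrafilter I) (β : I → Type*) : Setoid (∀ i, β i) where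
  r f g := {i | f i = g i} ∈ U
  iseqv := by
    refine ⟨fun f => ?_, fun {f g} h => ?_, fun {f g h} h1 h2 => ?_⟩
    · exact Filter.univ_mem' (fun i => rfl)
    · exact Filter.mem_of_superset h fun i hi => (hi : f i = g i).symm
    · exact Filter.mem_of_superset (Filter.inter_mem h1 h2) fun i hi =>
        (hi.1 : f i = g i).trans hi.2

def UProd (U : Ultrafilter I) (β : I → Type*) : Type _ := Quotient (uSetoid U β)

def uMk (U : Ultrafilter I) {β : I → Type*} (f : ∀ i, β i) : UProd U β :=
  Quotient.mk (uSetoid U β) f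

lemma uMk_surjective (U : Ultrafilter I) (β : I → Type*) :
    Function.Surjective (uMk U (β := β)) := Quotient.mk''_surjective

/-- `θ(α^U)`: the subset of the ultraproduct determined by a family of subsets. -/
def thetaSet (U : Ultrafilter I) {β : I → Type*} (α : ∀ i, Set (β i)) : Set (UProd U β) :=
  fun m => Quotient.liftOn m (fun f => {i | f i ∈ α i} ∈ U) (by
    intro f g hfg
    refine propext ⟨fun hf => ?_, fun hg => ?_⟩
    · exact Filter.mem_of_superset (Filter.inter_mem hf hfg) fun i hi =>
        show g i ∈ α i from hi.2 ▸ hi.1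
    · exact Filter.mem_of_superset (Filter.inter_mem hg hfg) fun i hi =>
        show f i ∈ α i from hi.2.symm ▸ hi.1)

lemma mem_thetaSet (U : Ultrafilter I) {β : I → Type*} (α : ∀ i, Set (β i)) (f : ∀ i, β i) :
    uMk U f ∈ thetaSet U α ↔ {i | f i ∈ α i} ∈ U := Iff.rfl

end UProd

/-! ### Completions: closed/open elements, density, compactness -/

section Completion
variable {C : Type*} [CompleteLattice C]

def ClosedElt (img : Set C) (c : C) : Prop := ∃ S ⊆ img, c = sInf S

def OpenElt (img : Set C) (c : C) : Prop := ∃ S ⊆ img, c = sSup S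

/-- The completion with image `img` is dense. -/
def DenseCompletion (img : Set C) : Prop :=
  ∀ x : C, (∃ G, (∀ c ∈ G, ClosedElt img c) ∧ x = sSup G) ∧
    (∃ G, (∀ o ∈ G, OpenElt img o) ∧ x = sInf G)

/-- The completion with image `img` is compact. -/
def CompactCompletion (img : Set C) : Prop :=
  ∀ S T : Set C, (∀ c ∈ S, ClosedElt img c) → (∀ o ∈ T, OpenElt img o) →
    sInf S ≤ sSup T →
      ∃ S' T' : Finset C, ↑S' ⊆ S ∧ ↑T' ⊆ T ∧ sInf (S' : Set C) ≤ sSup (T' : Set C)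

def JoinDense (img : Set C) : Prop := ∀ x : C, ∃ G ⊆ img, x = sSup G

def MeetDense (img : Set C) : Prop := ∀ x : C, ∃ G ⊆ img, x = sInf G

/-! Canonical and MacNeille extensions of `n`-ary isotone maps. -/

variable {L : Type*}

def lowerCanExt {n : ℕ} (η : L → C) (g : (Fin n → L) → L) (x : Fin n → C) : C :=
  sSup {z | ∃ p : Fin n → C, (∀ j, ClosedElt (Set.range η) (p j)) ∧ (∀ j, p j ≤ x j) ∧
    z = sInf {w | ∃ a : Fin n → L, (∀ j, p j ≤ η (a j)) ∧ w = η (g a)}}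

def upperCanExt {n : ℕ} (η : L → C) (g : (Fin n → L) → L) (x : Fin n → C) : C :=
  sInf {z | ∃ q : Fin n → C, (∀ j, OpenElt (Set.range η) (q j)) ∧ (∀ j, x j ≤ q j) ∧
    z = sSup {w | ∃ a : Fin n → L, (∀ j, η (a j) ≤ q j) ∧ w = η (g a)}}

def lowerMacExt {n : ℕ} (η : L → C) (g : (Fin n → L) → L) (x : Fin n → C) : C :=
  sSup {w | ∃ a : Fin n → L, (∀ j, η (a j) ≤ x j) ∧ w = η (g a)}

def upperMacExt {n : ℕ} (η : L → C) (g : (Fin n → L) → L) (x : Fin n → C) : C :=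
  sInf {w | ∃ a : Fin n → L, (∀ j, x j ≤ η (a j)) ∧ w = η (g a)}

/-- `F` preserves arbitrary joins (including the empty join) in each coordinate. -/
def CompleteNormalOp {n : ℕ} (F : (Fin n → C) → C) : Prop :=
  ∀ (as : Fin n → C) (j : Fin n) (G : Set C),
    F (Function.update as j (sSup G)) = ⨆ B ∈ G, F (Function.update as j B)

/-- `F` preserves arbitrary meets (including the empty meet) in each coordinate. -/
def CompleteNormalDualOp {n : ℕ} (F : (Fin n → C) → C) : Prop :=
  ∀ (as : Fin n → C) (j : Fin n) (G : Set C),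
    F (Function.update as j (sInf G)) = ⨅ B ∈ G, F (Function.update as j B)

end Completion

/-! ### First-order polarity-based structures and definable operations -/

section FO

/-- The language with `n` fresh unary relation symbols `S₀, …, S_{n-1}`. -/
def unaryLang (n : ℕ) : FirstOrder.Language where
  Functions := fun _ => Empty
  Relations := fun k => match k with
    | 1 => Fin n
    | _ => Empty

/-- The structure interpreting each `Sₘ` as `A m`. -/
def unaryStructure {M : Type*} {n : ℕ} (A : Fin n → Set M) : (unaryLang n).Structure M where
  funMap := fun {k} f _ => f.elim
  RelMap := fun {k} => match k with
    | 0 => fun r _ => r.elim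
    | 1 => fun r v => v 0 ∈ A r
    | (_ + 2) => fun r _ => r.elim

/-- The expansion `⟨P, A₀, …, A_{n-1}⟩` of a structure by `n` set parameters. -/
def withParams {L : FirstOrder.Language} {M : Type*} [L.Structure M] {n : ℕ}
    (A : Fin n → Set M) : (L.sum (unaryLang n)).Structure M :=
  letI := unaryStructure A
  inferInstance

variable {L : FirstOrder.Language} {M : Type*} [L.Structure M]

def pX (Xb : L.Relations 1) (M : Type*) [L.Structure M] : Set M := {m | RelMap Xb ![m]}

def pR (Rb : L.Relations 2) : M → M → Prop := fun a b => RelMap Rb ![a, b]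

/-- The operation on subsets of `X` defined by a formula `φ(v)` of `𝓛*_n`:
`f^P_φ(A₀,…,A_{n-1}) = {x ∈ X : ⟨P, A⟩ ⊨ φ[x]}`. -/
def defOp (Xb : L.Relations 1) {n : ℕ}
    (φ : (L.sum (unaryLang n)).Formula (Fin 1)) (A : Fin n → Set M) : Set M :=
  {x | x ∈ pX Xb M ∧ @Formula.Realize _ M (withParams A) _ φ (fun _ => x)}

/-- Set-based polarity data inside a one-sorted universe. -/
def rhoS (Yset : Set M) (R : M → M → Prop) (A : Set M) : Set M :=
  {y | y ∈ Yset ∧ ∀ x ∈ A, R x y}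

def lamS (Xset : Set M) (R : M → M → Prop) (B : Set M) : Set M :=
  {x | x ∈ Xset ∧ ∀ y ∈ B, R x y}

def IsStableS (Xset Yset : Set M) (R : M → M → Prop) (A : Set M) : Prop :=
  A ⊆ Xset ∧ lamS Xset R (rhoS Yset R A) ⊆ A

def StableS (Xset Yset : Set M) (R : M → M → Prop) : Type _ :=
  {A : Set M // IsStableS Xset Yset R A}

namespace StableS

variable {Xset Yset : Set M} {R : M → M → Prop}

lemma lamS_subset (B : Set M) : lamS Xset R B ⊆ Xset := fun _ hx => hx.1

lemma rhoS_anti {A B : Set M} (h : A ⊆ B) : rhoS Yset R B ⊆ rhoS Yset R A :=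
  fun y hy => ⟨hy.1, fun x hx => hy.2 x (h hx)⟩

lemma lamS_anti {B B' : Set M} (h : B ⊆ B') : lamS Xset R B' ⊆ lamS Xset R B :=
  fun x hx => ⟨hx.1, fun y hy => hx.2 y (h hy)⟩

lemma lamrhoS_mono {A B : Set M} (h : A ⊆ B) :
    lamS Xset R (rhoS Yset R A) ⊆ lamS Xset R (rhoS Yset R B) :=
  lamS_anti (rhoS_anti (Yset := Yset) h)

instance : PartialOrder (StableS Xset Yset R) :=
  inferInstanceAs (PartialOrder {A : Set M // IsStableS Xset Yset R A})

lemma le_def {A B : StableS Xset Yset R} : A ≤ B ↔ A.1 ⊆ B.1 := Iff.rfl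

instance : InfSet (StableS Xset Yset R) :=
  ⟨fun S => ⟨Xset ∩ ⋂ A ∈ S, A.1,
    ⟨Set.inter_subset_left, fun x hx =>
      ⟨(lamS_subset _) hx, Set.mem_iInter₂.2 fun A hA =>
        A.2.2 (lamrhoS_mono (Set.inter_subset_right.trans (Set.biInter_subset_of_mem hA)) hx)⟩⟩⟩⟩

instance : CompleteLattice (StableS Xset Yset R) :=
  completeLatticeOfInf _ (fun S =>
    ⟨fun A hA => (Set.inter_subset_right.trans (Set.biInter_subset_of_mem hA) :
        Xset ∩ ⋂ A ∈ S, A.1 ⊆ A.1),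
     fun B hB => Set.subset_inter B.2.1 (Set.subset_iInter₂ fun A hA => hB hA)⟩)

end StableS

end FO

end PaperCore

namespace PaperCore
section FO2
variable {I : Type*}

/-- `f^U`: the element of the ultraproduct determined by `f ∈ ∏_I M_i`. -/
def pmk (U : Ultrafilter I) {M : I → Type*} (f : ∀ i, M i) : (U : Filter I).Product M :=
  Quotient.mk (Filter.productSetoid (U : Filter I) M) f

/-- `θ(α^U) = {f^U ∈ ∏_U M_i : {i : f(i) ∈ α(i)} ∈ U}`. -/
def thetaSetP (U : Ultrafilter I) {M : I → Type*} (α : ∀ i, Set (M i)) :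
    Set ((U : Filter I).Product M) :=
  fun m => Quotient.liftOn (s := Filter.productSetoid (U : Filter I) M) m
    (fun f => {i | f i ∈ α i} ∈ U) (by
      intro f g hfg
      have hfg' : {i | f i = g i} ∈ U := hfg
      refine propext ⟨fun hf => ?_, fun hg => ?_⟩
      · exact Filter.mem_of_superset (Filter.inter_mem hf hfg') fun i hi =>
          show g i ∈ α i from hi.2 ▸ hi.1
      · exact Filter.mem_of_superset (Filter.inter_mem hg hfg') fun i hi =>
          show f i ∈ α i from hi.2.symm ▸ hi.1)

lemma mem_thetaSetP (U : Ultrafilter I) {M : I → Type*} (α : ∀ i, Set (M i)) (f : ∀ i, M i) :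
    pmk U f ∈ thetaSetP U α ↔ {i | f i ∈ α i} ∈ U := Iff.rfl

/-- The ultrapower `P^U` of a single universe `M`. -/
abbrev UPow (U : Ultrafilter I) (M : Type*) : Type _ := (U : Filter I).Product (fun _ : I => M)

/-- The stable set lattice `P⁺` of a polarity-based `𝓛*`-structure `M`. -/
abbrev StabFO {L : FirstOrder.Language} (Xb Yb : L.Relations 1) (Rb : L.Relations 2)
    (M : Type*) [L.Structure M] : Type _ :=
  StableS (pX Xb M) (pX Yb M) (pR (M := M) Rb)

end FO2
end PaperCore

namespace PaperCore

/-- A bundled `𝓛*`-structure (with nonempty universe). -/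
structure PolStruct (L : FirstOrder.Language) where
  carrier : Type
  [str : L.Structure carrier]
  [ne : Nonempty carrier]

attribute [instance] PolStruct.str PolStruct.ne

/-- `P` is based on a polarity: the symbols `X̄, Ȳ` cover the universe and `R̄` is typed. -/
def PolBased {L : FirstOrder.Language} (Xb Yb : L.Relations 1) (Rb : L.Relations 2)
    (P : PolStruct L) : Prop :=
  (∀ m : P.carrier, RelMap Xb ![m] ∨ RelMap Yb ![m]) ∧
  (∀ a b : P.carrier, RelMap Rb ![a, b] → RelMap Xb ![a] ∧ RelMap Yb ![b])

/-- The bundled ultraproduct of a family of bundled structures. -/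
noncomputable def uProdStruct {L : FirstOrder.Language} {I : Type} (U : Ultrafilter I)
    (P : I → PolStruct L) : PolStruct L where
  carrier := (U : Filter I).Product (fun i => (P i).carrier)
  str := inferInstance
  ne := ⟨pmk U (fun i => Classical.arbitrary _)⟩

/-- A bundled `Ω`-lattice. -/
structure OmLat (Ω : Type) (ar : Ω → ℕ) where
  carrier : Type
  [lat : Lattice carrier]
  [bdd : BoundedOrder carrier]
  ops : ∀ f : Ω, (Fin (ar f) → carrier) → carrier

attribute [instance] OmLat.lat OmLat.bdd

open scoped Classical in
/-- The restriction of the definable operation `f^P_{φ_f}` to the stable set lattice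
(taking value `⊥` in the irrelevant case where the value set is not stable). -/
noncomputable def dOp {L : FirstOrder.Language} (Xb Yb : L.Relations 1) (Rb : L.Relations 2)
    {Ω : Type} {ar : Ω → ℕ} (Φf : ∀ f : Ω, (L.sum (unaryLang (ar f))).Formula (Fin 1))
    (Mc : Type) [L.Structure Mc] (f : Ω) (As : Fin (ar f) → StabFO Xb Yb Rb Mc) :
    StabFO Xb Yb Rb Mc :=
  if h : IsStableS (pX Xb Mc) (pX Yb Mc) (pR Rb) (defOp Xb (Φf f) fun j => (As j).1)
  then ⟨_, h⟩ else ⊥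

/-- The `Ω`-lattice `P⁺_Ω`. -/
noncomputable def stableAlg {L : FirstOrder.Language} (Xb Yb : L.Relations 1)
    (Rb : L.Relations 2) {Ω : Type} {ar : Ω → ℕ}
    (Φf : ∀ f : Ω, (L.sum (unaryLang (ar f))).Formula (Fin 1)) (P : PolStruct L) :
    OmLat Ω ar where
  carrier := StabFO Xb Yb Rb P.carrier
  ops := dOp Xb Yb Rb Φf P.carrier

/-- `S` is (the underlying set of) an `Ω`-sublattice of `A`. -/
def IsSubClosed {Ω : Type} {ar : Ω → ℕ} (A : OmLat Ω ar) (S : Set A.carrier) : Prop :=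
  (∀ x ∈ S, ∀ y ∈ S, x ⊓ y ∈ S) ∧ (∀ x ∈ S, ∀ y ∈ S, x ⊔ y ∈ S) ∧
  (⊤ : A.carrier) ∈ S ∧ (⊥ : A.carrier) ∈ S ∧
  (∀ (f : Ω) (as : Fin (ar f) → A.carrier), (∀ j, as j ∈ S) → A.ops f as ∈ S)

/-- The direct product of a family of `Ω`-lattices, with coordinatewise operations. -/
def prodAlg {Ω : Type} {ar : Ω → ℕ} {J : Type} (A : J → OmLat Ω ar) : OmLat Ω ar where
  carrier := ∀ j, (A j).carrier
  ops := fun f as j => (A j).ops f (fun k => as k j)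

/-- `B` is a homomorphic image of the `Ω`-sublattice `S` of `A`. -/
def OmHomOnto {Ω : Type} {ar : Ω → ℕ} (A B : OmLat Ω ar) (S : Set A.carrier)
    (hS : IsSubClosed A S) : Prop :=
  ∃ h : S → B.carrier, Function.Surjective h ∧
    (∀ x y : S, h ⟨x.1 ⊓ y.1, hS.1 x.1 x.2 y.1 y.2⟩ = h x ⊓ h y) ∧
    (∀ x y : S, h ⟨x.1 ⊔ y.1, hS.2.1 x.1 x.2 y.1 y.2⟩ = h x ⊔ h y) ∧
    h ⟨⊤, hS.2.2.1⟩ = ⊤ ∧ h ⟨⊥, hS.2.2.2.1⟩ = ⊥ ∧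
    (∀ (f : Ω) (as : Fin (ar f) → S),
      h ⟨A.ops f (fun j => (as j).1), hS.2.2.2.2 f _ (fun j => (as j).2)⟩ =
        B.ops f (fun j => h (as j)))

/-- The variety generated by a class `G` of `Ω`-lattices: all homomorphic images of
`Ω`-sublattices of direct products of members of `G`. -/
def genVariety {Ω : Type} {ar : Ω → ℕ} (G : Set (OmLat Ω ar)) : Set (OmLat Ω ar) :=
  {B | ∃ (J : Type) (A : J → OmLat Ω ar), (∀ j, A j ∈ G) ∧
    ∃ (S : Set (prodAlg A).carrier) (hS : IsSubClosed (prodAlg A) S),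
      OmHomOnto (prodAlg A) B S hS}

end PaperCore

/-! ### Good ultrafilters -/

namespace GoodUltrafilter

open Cardinal

variable {T κ ι : Type}

/-- The functions `g i` with `i ∉ E` are independent modulo the filter `F`. -/
def Indep (g : ι → T → Finset κ) (F : Filter T) (E : Set ι) : Prop :=
  ∀ A ∈ F, ∀ w : Finset ι, (∀ i ∈ w, i ∉ E) → ∀ v : ι → Finset κ, ∃ t ∈ A, ∀ i ∈ w, g i t = v i

/-- `σ` realizes the type coded by `φ` modulo the filter `F`. -/
def Realizes (F : Filter T) (φ : Finset κ → Set T) (σ : T → Finset κ) : Prop :=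
  (∀ᶠ t in F, t ∈ φ (σ t)) ∧ ∀ i, ∀ᶠ t in F, i ∈ σ t

lemma Realizes.mono {F F' : Filter T} (h : F' ≤ F) {φ : Finset κ → Set T} {σ : T → Finset κ}
    (hσ : Realizes F φ σ) : Realizes F' φ σ :=
  ⟨hσ.1.filter_mono h, fun i => (hσ.2 i).filter_mono h⟩

lemma Indep.mono {g : ι → T → Finset κ} {F : Filter T} {E E' : Set ι} (h : Indep g F E)
    (hE : E ⊆ E') : Indep g F E' :=
  fun A hA w hw v => h A hA w (fun i hi hiE => hw i hi (hE hiE)) v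

lemma Indep.neBot {g : ι → T → Finset κ} {F : Filter T} {E : Set ι} (h : Indep g F E) :
    F.NeBot := by
  refine ⟨fun hF => ?_⟩
  obtain ⟨t, ht, -⟩ := h ∅ (by rw [hF]; trivial) ∅ (by simp) (fun _ => ∅)
  exact ht

/-- Any antitone `φ` can be decided by shrinking the filter, at the cost of finitely many
members of the independent family. -/
lemma Indep.exists_decide {g : ι → T → Finset κ} {F : Filter T} {E : Set ι} (h : Indep g F E)
    (hE : E ≠ Set.univ) (φ : Finset κ → Set T) :
    ∃ r : Filter T × Finset ι, r.1 ≤ F ∧ Indep g r.1 (E ∪ r.2) ∧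
      (Antitone φ → (∃ s, (φ s)ᶜ ∈ r.1) ∨ ∃ σ, Realizes r.1 φ σ) := by
  classical
  by_cases hφ : Antitone φ
  swap
  · exact ⟨(F, ∅), le_rfl, h.mono Set.subset_union_left, fun h' => absurd h' hφ⟩
  by_cases hc : ∃ A ∈ F, ∃ s, ∃ w : Finset ι, (∀ i ∈ w, i ∉ E) ∧ ∃ v : ι → Finset κ,
      ∀ t ∈ A, t ∈ φ s → ¬ ∀ i ∈ w, g i t = v i
  · obtain ⟨A, hA, s, w, hw, v, hv⟩ := hc
    refine ⟨(F ⊓ Filter.principal {t | ∀ i ∈ w, g i t = v i}, w), inf_le_left, ?_,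
      fun _ => Or.inl ⟨s, ?_⟩⟩
    · intro A' hA' w' hw' v'
      rw [Filter.mem_inf_principal] at hA'
      obtain ⟨t, ht, ht'⟩ := h _ hA' (w ∪ w') (fun i hi hiE => by
        rcases Finset.mem_union.1 hi with hi | hi
        · exact hw i hi hiE
        · exact hw' i hi (Or.inl hiE)) (fun i => if i ∈ w then v i else v' i)
      refine ⟨t, ht fun i hi => ?_, fun i hi => ?_⟩
      · simpa [hi] using ht' i (Finset.mem_union_left _ hi)
      · have hiw : i ∉ w := fun hiw => hw' i hi (Or.inr hiw)
        simpa [hiw] using ht' i (Finset.mem_union_right _ hi)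
    · rw [Filter.mem_inf_principal]
      filter_upwards [hA] with t ht hw hts using hv t ht hts hw
  · push Not at hc
    obtain ⟨i₀, hi₀⟩ := (Set.ne_univ_iff_exists_notMem _).1 hE
    let B : Finset κ → Set T := fun s => {t | s ⊆ g i₀ t ∧ t ∈ φ (g i₀ t)}
    have hB : Directed (· ≥ ·) fun s => Filter.principal (B s) := by
      intro s s'
      refine ⟨s ∪ s', ?_, ?_⟩ <;>
      · simp only [ge_iff_le, Filter.le_principal_iff, Filter.mem_principal]
        exact fun t ht => ⟨fun i hi => ht.1 (by simp [hi]), ht.2⟩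
    have hmem : ∀ s, B s ∈ F ⊓ ⨅ s, Filter.principal (B s) := fun s =>
      Filter.mem_inf_of_right (Filter.mem_iInf_of_mem s (Filter.mem_principal_self _))
    refine ⟨(F ⊓ ⨅ s, Filter.principal (B s), {i₀}), inf_le_left, ?_,
      fun _ => Or.inr ⟨g i₀, ?_, fun i => ?_⟩⟩
    · intro A hA w hw v
      obtain ⟨A₁, hA₁, A₂, hA₂, rfl⟩ := Filter.mem_inf_iff.1 hA
      obtain ⟨s, hs⟩ := (Filter.mem_iInf_of_directed hB _).1 hA₂
      have hw₀ : i₀ ∉ w := fun hi => hw i₀ hi (Or.inr (by simp))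
      obtain ⟨t, ht, hts, htw⟩ := hc A₁ hA₁ s (insert i₀ w) (fun i hi => by
        rcases Finset.mem_insert.1 hi with rfl | hi
        · exact hi₀
        · exact fun hiE => hw i hi (Or.inl hiE)) (fun i => if i = i₀ then s else v i)
      have h₀ : g i₀ t = s := by simpa using htw i₀ (Finset.mem_insert_self _ _)
      refine ⟨t, ⟨ht, hs ⟨h₀.ge, h₀ ▸ hts⟩⟩, fun i hi => ?_⟩
      have hne : i ≠ i₀ := fun h => hw₀ (h ▸ hi)
      simpa [hne] using htw i (Finset.mem_insert_of_mem hi)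
    · filter_upwards [hmem ∅] with t ht using ht.2
    · filter_upwards [hmem {i}] with t ht using ht.1 (by simp)

open Classical in
/-- One step of the construction. -/
noncomputable def decideStep (g : ι → T → Finset κ) (F : Filter T) (E : Set ι)
    (φ : Finset κ → Set T) : Filter T × Finset ι :=
  if h : Indep g F E ∧ E ≠ Set.univ then (h.1.exists_decide h.2 φ).choose else (F, ∅)

/-- The transfinite iteration of `decideStep` along a well-order. -/
noncomputable def decideRec (g : ι → T → Finset κ)
    (r : (Finset κ → Set T) → (Finset κ → Set T) → Prop) [IsWellOrder _ r] :
    (Finset κ → Set T) → Filter T × Finset ι :=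
  (IsWellFounded.wf (r := r)).fix fun φ rec =>
    decideStep g (⨅ ψ : {ψ // r ψ φ}, (rec ψ.1 ψ.2).1) (⋃ ψ : {ψ // r ψ φ}, ↑(rec ψ.1 ψ.2).2) φ

lemma decideRec_eq (g : ι → T → Finset κ)
    (r : (Finset κ → Set T) → (Finset κ → Set T) → Prop) [IsWellOrder _ r]
    (φ : Finset κ → Set T) :
    decideRec g r φ = decideStep g (⨅ ψ : {ψ // r ψ φ}, (decideRec g r ψ.1).1)
      (⋃ ψ : {ψ // r ψ φ}, ↑(decideRec g r ψ.1).2) φ :=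
  WellFounded.fix_eq _ _ _

lemma exists_ultrafilter_of_indep (g : ι → T → Finset κ) (hg : Indep g ⊤ ∅)
    (hunc : ℵ₀ < #(Finset κ → Set T)) (hcard : #(Finset κ → Set T) ≤ #ι) :
    ∃ U : Ultrafilter T, ∀ φ : Finset κ → Set T, Antitone φ → (∀ s, φ s ∈ U) →
      ∃ σ, Realizes (U : Filter T) φ σ := by
  obtain ⟨r, wo, hr⟩ := Cardinal.exists_ord_eq (Finset κ → Set T)
  let F : (Finset κ → Set T) → Filter T := fun φ => (decideRec g r φ).1
  let E : (Finset κ → Set T) → Set ι := fun φ => ⋃ ψ : {ψ // r ψ φ}, ↑(decideRec g r ψ.1).2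
  have hE : ∀ φ, E φ ≠ Set.univ := by
    intro φ hEφ
    have h1 : #(E φ) < #ι := by
      refine lt_of_lt_of_le ?_ hcard
      refine (Cardinal.mk_iUnion_le _).trans_lt ?_
      refine Cardinal.mul_lt_of_lt hunc.le ?_ ?_
      · have := Ordinal.typein_lt_type r φ
        rw [← hr, Cardinal.lt_ord] at this
        exact this
      · refine lt_of_le_of_lt (ciSup_le' fun ψ => ?_) hunc
        exact Cardinal.mk_le_aleph0
    rw [hEφ, Cardinal.mk_univ] at h1
    exact lt_irrefl _ h1
  have key : ∀ φ, Indep g (F φ) (E φ ∪ (decideRec g r φ).2) ∧ (∀ ψ, r ψ φ → F φ ≤ F ψ) ∧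
      (Antitone φ → (∃ s, (φ s)ᶜ ∈ F φ) ∨ ∃ σ, Realizes (F φ) φ σ) := by
    intro φ
    induction φ using (IsWellFounded.wf (r := r)).induction with
    | _ φ ih =>
    have hdir : Directed (· ≥ ·) fun ψ : {ψ // r ψ φ} => F ψ.1 := by
      rintro ⟨a, ha⟩ ⟨b, hb⟩
      rcases trichotomous_of r a b with hab | rfl | hab
      · exact ⟨⟨b, hb⟩, (ih b hb).2.1 a hab, le_rfl⟩
      · exact ⟨⟨a, ha⟩, le_rfl, le_rfl⟩
      · exact ⟨⟨a, ha⟩, le_rfl, (ih a ha).2.1 b hab⟩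
    have hind : Indep g (⨅ ψ : {ψ // r ψ φ}, F ψ.1) (E φ) := by
      rcases isEmpty_or_nonempty {ψ // r ψ φ} with he | hne
      · rw [iInf_of_empty]
        exact hg.mono (Set.empty_subset _)
      · intro A hA
        obtain ⟨⟨ψ, hψ⟩, hA⟩ := (Filter.mem_iInf_of_directed hdir _).1 hA
        refine ((ih ψ hψ).1.mono ?_) A hA
        refine Set.union_subset (Set.iUnion_subset fun χ => ?_) ?_
        · exact Set.subset_iUnion (fun χ : {χ // r χ φ} => (↑(decideRec g r χ.1).2 : Set ι))
            ⟨χ.1, trans_of r χ.2 hψ⟩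
        · exact Set.subset_iUnion (fun χ : {χ // r χ φ} => (↑(decideRec g r χ.1).2 : Set ι))
            ⟨ψ, hψ⟩
    have heq : decideRec g r φ = (hind.exists_decide (hE φ) φ).choose := by
      rw [decideRec_eq, decideStep]
      exact dif_pos ⟨hind, hE φ⟩
    have hspec := (hind.exists_decide (hE φ) φ).choose_spec
    rw [← heq] at hspec
    exact ⟨hspec.2.1, fun ψ hψ => hspec.1.trans (iInf_le _ (⟨ψ, hψ⟩ : {ψ // r ψ φ})), hspec.2.2⟩
  have hdir : Directed (· ≥ ·) F := by
    intro a b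
    rcases trichotomous_of r a b with hab | rfl | hab
    · exact ⟨b, (key b).2.1 a hab, le_rfl⟩
    · exact ⟨a, le_rfl, le_rfl⟩
    · exact ⟨a, le_rfl, (key a).2.1 b hab⟩
  have hne : (⨅ φ, F φ).NeBot := by
    have : ∀ φ, (F φ).NeBot := fun φ => (key φ).1.neBot
    have : Nonempty (Finset κ → Set T) := ⟨fun _ => ∅⟩
    exact Filter.iInf_neBot_of_directed' hdir ‹_›
  refine ⟨Ultrafilter.of (⨅ φ, F φ), fun φ hφ hU => ?_⟩
  have hle : (Ultrafilter.of (⨅ φ, F φ) : Filter T) ≤ F φ :=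
    (Ultrafilter.of_le _).trans (iInf_le _ _)
  rcases (key φ).2.2 hφ with ⟨s, hs⟩ | ⟨σ, hσ⟩
  · exact absurd (hU s) (Ultrafilter.compl_mem_iff_notMem.1 (hle hs))
  · exact ⟨σ, hσ.mono hle⟩

open Classical in
/-- An independent family of functions, indexed by the subsets of `κ`. -/
noncomputable def indepFun (X : Set κ) (t : Finset κ × Finset (Finset κ × Finset κ)) : Finset κ :=
  if h : ∃ v, (t.1.filter (· ∈ X), v) ∈ t.2 then h.choose else ∅

lemma indep_indepFun [Nonempty κ] : Indep (indepFun (κ := κ)) ⊤ ∅ := by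
  classical
  intro A hA w _ v
  rw [Filter.mem_top] at hA
  subst hA
  have hsep : ∀ X Y : Set κ, ∃ i, (i ∈ X ↔ i ∈ Y) → X = Y := by
    intro X Y
    by_contra! hq
    exact (hq (Classical.arbitrary κ)).2 (Set.ext fun i => (hq i).1)
  choose d hd using hsep
  let s : Finset κ := (w ×ˢ w).image fun q => d q.1 q.2
  refine ⟨(s, w.image fun X => (s.filter (· ∈ X), v X)), trivial, fun X hX => ?_⟩
  have h : ∃ v', (s.filter (· ∈ X), v') ∈ w.image fun X => (s.filter (· ∈ X), v X) :=
    ⟨v X, Finset.mem_image_of_mem _ hX⟩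
  rw [indepFun, dif_pos h]
  obtain ⟨Y, hY, hYX⟩ := Finset.mem_image.1 h.choose_spec
  obtain ⟨h1, h2⟩ := Prod.mk.inj hYX
  have hds : d X Y ∈ s := Finset.mem_image.2 ⟨(X, Y), Finset.mk_mem_product hX hY, rfl⟩
  have hiff : d X Y ∈ X ↔ d X Y ∈ Y := by
    have := Finset.ext_iff.1 h1 (d X Y)
    simp only [Finset.mem_filter, hds, true_and] at this
    exact this.symm
  rw [← h2, hd X Y hiff]

theorem exists_good (κ : Type) [Infinite κ] : ∃ (T : Type) (U : Ultrafilter T),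
    ∀ φ : Finset κ → Set T, Antitone φ → (∀ s, φ s ∈ U) →
      ∃ σ, Realizes (U : Filter T) φ σ := by
  have hT : #(Finset κ × Finset (Finset κ × Finset κ)) = #κ := by
    simp [Cardinal.mk_finset_of_infinite]
  have hcard : #(Finset κ → Set (Finset κ × Finset (Finset κ × Finset κ))) = #(Set κ) := by
    rw [← Cardinal.power_def, Cardinal.mk_set, Cardinal.mk_set, hT,
      Cardinal.mk_finset_of_infinite, ← Cardinal.power_mul,
      Cardinal.mul_eq_self (Cardinal.aleph0_le_mk κ)]
  refine ⟨_, exists_ultrafilter_of_indep indepFun indep_indepFun ?_ hcard.le⟩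
  rw [hcard, Cardinal.mk_set]
  exact (Cardinal.aleph0_le_mk κ).trans_lt (Cardinal.cantor _)

end GoodUltrafilter

/-! ### Canonical extensions inside completions of saturated ultrapowers -/

namespace PaperCore

section CompleteOperators

variable {C : Type*} [CompleteLattice C] {n : ℕ}

lemma CompleteNormalOp.monotone {F : (Fin n → C) → C} (hF : CompleteNormalOp F) : Monotone F := by
  classical
  intro x y hxy
  suffices h : ∀ s : Finset (Fin n), F x ≤ F (s.piecewise y x) by
    simpa using h Finset.univ
  intro s
  induction s using Finset.induction_on with
  | empty => simp
  | insert j s hj ih =>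
    refine ih.trans ?_
    have h1 : s.piecewise y x = Function.update (s.piecewise y x) j (x j) := by
      rw [eq_comm, Function.update_eq_self_iff]
      simp [hj]
    have h2 : y j = sSup {x j, y j} := by rw [sSup_pair, sup_eq_right.2 (hxy j)]
    rw [Finset.piecewise_insert, h2, hF]
    conv_lhs => rw [h1]
    exact le_iSup₂_of_le (f := fun B _ => F (Function.update (s.piecewise y x) j B)) (x j)
      (Or.inl rfl) le_rfl

lemma CompleteNormalOp.apply_sSup_le {F : (Fin n → C) → C} (hF : CompleteNormalOp F)
    (G : Fin n → Set C) (z : C) (h : ∀ B : Fin n → C, (∀ j, B j ∈ G j) → F B ≤ z) :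
    F (fun j => sSup (G j)) ≤ z := by
  classical
  suffices h' : ∀ s : Finset (Fin n), ∀ B : Fin n → C, (∀ j ∈ s, B j = sSup (G j)) →
      (∀ j ∉ s, B j ∈ G j) → F B ≤ z from
    h' Finset.univ _ (fun _ _ => rfl) (fun j hj => absurd (Finset.mem_univ j) hj)
  intro s
  induction s using Finset.induction_on with
  | empty => exact fun B _ hB => h B fun j => hB j (Finset.notMem_empty j)
  | insert j s hj ih =>
    intro B hB hB'
    have h1 : B = Function.update B j (sSup (G j)) := by
      rw [eq_comm, Function.update_eq_self_iff]
      exact (hB j (Finset.mem_insert_self j s)).symm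
    rw [h1, hF]
    refine iSup₂_le fun c hc => ih _ (fun i hi => ?_) (fun i hi => ?_)
    · have hij : i ≠ j := fun h => hj (h ▸ hi)
      rw [Function.update_of_ne hij]
      exact hB i (Finset.mem_insert_of_mem hi)
    · by_cases hij : i = j
      · subst hij; simpa using hc
      · rw [Function.update_of_ne hij]
        exact hB' i (by simp [hij, hi])

lemma CompleteNormalDualOp.dual {F : (Fin n → C) → C} (hF : CompleteNormalDualOp F) :
    CompleteNormalOp (C := Cᵒᵈ) F := hF

lemma CompleteNormalDualOp.monotone {F : (Fin n → C) → C} (hF : CompleteNormalDualOp F) :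
    Monotone F :=
  fun _ _ h => hF.dual.monotone h

end CompleteOperators

/-- `θ` represents the ultraproduct of the lattices `N t` as a join-dense and meet-dense
subset of the complete lattice `M`. -/
structure UltraRep {T : Type} (U : Ultrafilter T) {N : T → Type} [∀ t, CompleteLattice (N t)]
    {M : Type} [CompleteLattice M] (θ : (∀ t, N t) → M) : Prop where
  le_iff : ∀ A B, θ A ≤ θ B ↔ ∀ᶠ t in U, A t ≤ B t
  join_dense : ∀ m m' : M, (∀ A, θ A ≤ m → θ A ≤ m') → m ≤ m'
  meet_dense : ∀ m m' : M, (∀ A, m' ≤ θ A → m ≤ θ A) → m ≤ m'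

namespace UltraRep

variable {T : Type} {U : Ultrafilter T} {N : T → Type} [∀ t, CompleteLattice (N t)]
  {M : Type} [CompleteLattice M] {θ : (∀ t, N t) → M}

lemma dual (h : UltraRep U θ) : UltraRep (N := fun t => (N t)ᵒᵈ) (M := Mᵒᵈ) U θ where
  le_iff A B := h.le_iff B A
  join_dense m m' := h.meet_dense m' m
  meet_dense m m' := h.join_dense m' m

lemma mono (h : UltraRep U θ) {A B : ∀ t, N t} (hAB : A ≤ B) : θ A ≤ θ B :=
  (h.le_iff A B).2 (Filter.Eventually.of_forall hAB)

lemma map_sup (h : UltraRep U θ) (A B : ∀ t, N t) : θ (A ⊔ B) = θ A ⊔ θ B := by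
  refine le_antisymm (h.meet_dense _ _ fun D hD => ?_) (sup_le (h.mono le_sup_left)
    (h.mono le_sup_right))
  obtain ⟨h1, h2⟩ := sup_le_iff.1 hD
  refine (h.le_iff _ _).2 ?_
  filter_upwards [(h.le_iff _ _).1 h1, (h.le_iff _ _).1 h2] with t h1 h2 using sup_le h1 h2

lemma map_inf (h : UltraRep U θ) (A B : ∀ t, N t) : θ (A ⊓ B) = θ A ⊓ θ B :=
  h.dual.map_sup A B

lemma map_top (h : UltraRep U θ) : θ ⊤ = ⊤ :=
  top_le_iff.1 (h.join_dense _ _ fun _ _ => h.mono le_top)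

lemma map_bot (h : UltraRep U θ) : θ ⊥ = ⊥ :=
  h.dual.map_top

end UltraRep

section Compactness

variable {S C : Type} [CompleteLattice C]

lemma DenseCompletion.dual {img : Set C} (h : DenseCompletion img) :
    DenseCompletion (C := Cᵒᵈ) img :=
  fun x => (h x).symm

lemma DenseCompletion.le_of_forall_closed {img : Set C} (h : DenseCompletion img) {x y : C}
    (hxy : ∀ p, ClosedElt img p → p ≤ x → p ≤ y) : x ≤ y := by
  obtain ⟨G, hG, rfl⟩ := (h x).1
  exact sSup_le fun c hc => hxy c (hG c hc) (le_sSup hc)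

lemma DenseCompletion.le_of_forall_open {img : Set C} (h : DenseCompletion img) {x y : C}
    (hxy : ∀ q, OpenElt img q → y ≤ q → x ≤ q) : x ≤ y :=
  h.dual.le_of_forall_closed hxy

lemma CompactCompletion.dual {img : Set C} (h : CompactCompletion img) :
    CompactCompletion (C := Cᵒᵈ) img := by
  intro P Q hP hQ hPQ
  obtain ⟨S', T', h1, h2, h3⟩ := h Q P hQ hP hPQ
  exact ⟨T', S', h2, h1, h3⟩

lemma ClosedElt.eq_sInf {k : S → C} {p : C} (hp : ClosedElt (Set.range k) p) :
    p = sInf (k '' {a | p ≤ k a}) := by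
  obtain ⟨G, hG, rfl⟩ := hp
  refine le_antisymm (le_sInf ?_) (le_sInf fun c hc => ?_)
  · rintro _ ⟨a, ha, rfl⟩
    exact ha
  · obtain ⟨a, rfl⟩ := hG hc
    exact sInf_le ⟨a, sInf_le hc, rfl⟩

lemma OpenElt.eq_sSup {k : S → C} {q : C} (hq : OpenElt (Set.range k) q) :
    q = sSup (k '' {a | k a ≤ q}) :=
  ClosedElt.eq_sInf (S := S) (C := Cᵒᵈ) (k := k) hq

lemma closedElt_sInf_image (k : S → C) (P : Set S) : ClosedElt (Set.range k) (sInf (k '' P)) :=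
  ⟨_, Set.image_subset_range _ _, rfl⟩

variable [Lattice S] [BoundedOrder S]

/-- A nonempty subset closed under binary meets and containing `⊤`. -/
def InfClosedTop (P : Set S) : Prop := ⊤ ∈ P ∧ ∀ a ∈ P, ∀ b ∈ P, a ⊓ b ∈ P

/-- A nonempty subset closed under binary joins and containing `⊥`. -/
def SupClosedBot (P : Set S) : Prop := ⊥ ∈ P ∧ ∀ a ∈ P, ∀ b ∈ P, a ⊔ b ∈ P

lemma InfClosedTop.exists_le_sInf {k : BoundedLatticeHom S C} {P : Set S} (hP : InfClosedTop P)
    (s : Finset C) (hs : ↑s ⊆ k '' P) : ∃ a ∈ P, k a ≤ sInf (s : Set C) := by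
  classical
  induction s using Finset.induction_on with
  | empty => exact ⟨⊤, hP.1, by simp⟩
  | insert c s _ ih =>
    rw [Finset.coe_insert, Set.insert_subset_iff] at hs
    obtain ⟨a, ha, hka⟩ := ih hs.2
    obtain ⟨b, hb, rfl⟩ := hs.1
    refine ⟨b ⊓ a, hP.2 _ hb _ ha, ?_⟩
    rw [Finset.coe_insert, sInf_insert, InfHomClass.map_inf]
    exact inf_le_inf_left _ hka

lemma SupClosedBot.exists_sSup_le {k : BoundedLatticeHom S C} {Q : Set S} (hQ : SupClosedBot Q)
    (s : Finset C) (hs : ↑s ⊆ k '' Q) : ∃ a ∈ Q, sSup (s : Set C) ≤ k a :=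
  InfClosedTop.exists_le_sInf (S := Sᵒᵈ) (C := Cᵒᵈ) (k := BoundedLatticeHom.dual k) hQ s hs

lemma CompactCompletion.exists_le {k : BoundedLatticeHom S C}
    (hc : CompactCompletion (Set.range k)) {P Q : Set S} (hP : InfClosedTop P)
    (hQ : SupClosedBot Q) (h : sInf (k '' P) ≤ sSup (k '' Q)) :
    ∃ a ∈ P, ∃ a' ∈ Q, k a ≤ k a' := by
  obtain ⟨S', T', hS, hT, hST⟩ := hc (k '' P) (k '' Q)
    (by rintro _ ⟨a, -, rfl⟩; exact ⟨{k a}, by simp, by simp⟩)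
    (by rintro _ ⟨a, -, rfl⟩; exact ⟨{k a}, by simp, by simp⟩) h
  obtain ⟨a, ha, ha'⟩ := hP.exists_le_sInf S' hS
  obtain ⟨b, hb, hb'⟩ := hQ.exists_sSup_le T' hT
  exact ⟨a, ha, b, hb, ha'.trans (hST.trans hb')⟩

lemma infClosedTop_le (k : BoundedLatticeHom S C) (p : C) : InfClosedTop {a | p ≤ k a} :=
  ⟨by simp, fun a ha b hb => by simpa using ⟨ha, hb⟩⟩

lemma supClosedBot_le (k : BoundedLatticeHom S C) (q : C) : SupClosedBot {a | k a ≤ q} :=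
  infClosedTop_le (S := Sᵒᵈ) (C := Cᵒᵈ) (BoundedLatticeHom.dual k) q

end Compactness

/-- The saturation property of `U` for types over subsets of `S`. -/
def Saturating {T : Type} (U : Ultrafilter T) (S : Type) : Prop :=
  ∀ φ : Finset (S × ℕ) → Set T, Antitone φ → (∀ s, φ s ∈ U) →
    ∃ σ, GoodUltrafilter.Realizes (U : Filter T) φ σ

lemma Saturating.exists_lower {T S N : Type} [Lattice S] [BoundedOrder S] [CompleteLattice N]
    {U : Ultrafilter T} (hU : Saturating U S) {n : ℕ} {ι : S → N} (hι : Monotone ι)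
    (F : Fin n → Set S)
    (hF : ∀ j, InfClosedTop (F j)) (Pr : T → (Fin n → N) → Prop)
    (hmono : ∀ t A B, A ≤ B → Pr t A → Pr t B)
    (h : ∀ a : Fin n → S, (∀ j, a j ∈ F j) → ∀ᶠ t in U, Pr t fun j => ι (a j)) :
    ∃ b : Fin n → T → N, (∀ j, ∀ a ∈ F j, ∀ᶠ t in U, b j t ≤ ι a) ∧
      ∀ᶠ t in U, Pr t fun j => b j t := by
  classical
  let m : Finset (S × ℕ) → Fin n → S := fun s j =>
    (s.filter fun q => q.1 ∈ F j ∧ q.2 = (j : ℕ)).inf Prod.fst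
  have hm : ∀ s j, m s j ∈ F j := fun s j =>
    Finset.inf_induction (hF j).1 (hF j).2 fun q hq => (Finset.mem_filter.1 hq).2.1
  have hanti : ∀ s s', s ⊆ s' → ∀ j, m s' j ≤ m s j := fun s s' hs j =>
    Finset.inf_mono (Finset.filter_subset_filter _ hs)
  obtain ⟨σ, hσ, hσ'⟩ := hU (fun s => {t | Pr t fun j => ι (m s j)})
    (fun s s' hs t => hmono t _ _ fun j => hι (hanti s s' hs j))
    (fun s => h _ (hm s))
  refine ⟨fun j t => ι (m (σ t) j), fun j a ha => ?_, hσ⟩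
  filter_upwards [hσ' (a, j)] with t ht
  exact hι (Finset.inf_le (f := Prod.fst) (b := (a, (j : ℕ))) (by simp [ht, ha]))

section Extension

variable {T S C N M : Type} [Lattice S] [BoundedOrder S] [CompleteLattice C]
  [CompleteLattice N] [CompleteLattice M]

/-- The largest candidate below for the image of `x ∈ C` in `M`, generated by closed elements. -/
def lowerApprox (θ : (T → N) → M) (ι : S → N) (k : S → C) (x : C) : M :=
  sSup {m | ∃ b, m = θ b ∧ ∃ p, ClosedElt (Set.range k) p ∧ p ≤ x ∧
    ∀ a, p ≤ k a → θ b ≤ θ fun _ => ι a}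

/-- The smallest candidate above for the image of `x ∈ C` in `M`, generated by open elements. -/
def upperApprox (θ : (T → N) → M) (ι : S → N) (k : S → C) (x : C) : M :=
  sInf {m | ∃ c, m = θ c ∧ ∃ q, OpenElt (Set.range k) q ∧ x ≤ q ∧
    ∀ a, k a ≤ q → (θ fun _ => ι a) ≤ θ c}

/-- The open element of `C` below `θ c`. -/
def openBelow (θ : (T → N) → M) (ι : S → N) (k : S → C) (c : T → N) : C :=
  sSup (k '' {a | (θ fun _ => ι a) ≤ θ c})

/-- The closed element of `C` above `θ b`. -/
def closedAbove (θ : (T → N) → M) (ι : S → N) (k : S → C) (b : T → N) : C :=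
  sInf (k '' {a | θ b ≤ θ fun _ => ι a})

structure CanSetup (U : Ultrafilter T) (θ : (T → N) → M) (ι : BoundedLatticeHom S N)
    (k : BoundedLatticeHom S C) : Prop where
  sat : Saturating U S
  rep : UltraRep U θ
  dense : DenseCompletion (Set.range k)
  compact : CompactCompletion (Set.range k)

namespace CanSetup

variable {U : Ultrafilter T} {θ : (T → N) → M} {ι : BoundedLatticeHom S N}
  {k : BoundedLatticeHom S C}

lemma dual (h : CanSetup U θ ι k) :
    CanSetup (S := Sᵒᵈ) (C := Cᵒᵈ) (N := Nᵒᵈ) (M := Mᵒᵈ) U θ (BoundedLatticeHom.dual ι)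
      (BoundedLatticeHom.dual k) where
  sat := h.sat
  rep := h.rep.dual
  dense := h.dense.dual
  compact := h.compact.dual

lemma supClosedBot_const_le (h : CanSetup U θ ι k) (c : T → N) :
    SupClosedBot {a | (θ fun _ => ι a) ≤ θ c} := by
  refine ⟨?_, fun a ha b hb => ?_⟩
  · refine (h.rep.le_iff _ _).2 (Filter.Eventually.of_forall fun t => ?_)
    simp
  · refine (h.rep.le_iff _ _).2 ?_
    filter_upwards [(h.rep.le_iff _ _).1 ha, (h.rep.le_iff _ _).1 hb] with t h1 h2
    simpa using ⟨h1, h2⟩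

lemma exists_of_le_openBelow (h : CanSetup U θ ι k) {p : C} (hp : ClosedElt (Set.range k) p)
    {c : T → N} (hpc : p ≤ openBelow θ ι k c) : ∃ a, p ≤ k a ∧ (θ fun _ => ι a) ≤ θ c := by
  rw [hp.eq_sInf] at hpc
  obtain ⟨a, ha, a', ha', haa'⟩ :=
    h.compact.exists_le (infClosedTop_le k p) (h.supClosedBot_const_le c) hpc
  exact ⟨a', le_trans ha haa', ha'⟩

lemma exists_of_closedAbove_le (h : CanSetup U θ ι k) {q : C} (hq : OpenElt (Set.range k) q)
    {b : T → N} (hbq : closedAbove θ ι k b ≤ q) : ∃ a, k a ≤ q ∧ θ b ≤ θ fun _ => ι a :=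
  h.dual.exists_of_le_openBelow hq hbq

/-- If `θ c` bounds the images under `f` of all lower bounds of the filters of the `p j`, then
already the closed element generated by the images of these filters is below `c`. -/
lemma le_openBelow_of_forall (h : CanSetup U θ ι k) {c : T → N} {n : ℕ}
    {p : Fin n → C} {f : (Fin n → N) → N} (hf : Monotone f) {g : (Fin n → S) → S}
    (hfg : ∀ a : Fin n → S, f (fun j => ι (a j)) = ι (g a))
    (hb : ∀ b : Fin n → T → N, (∀ j a, p j ≤ k a → θ (b j) ≤ θ fun _ => ι a) →
      (θ fun t => f fun j => b j t) ≤ θ c) :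
    sInf {w | ∃ a : Fin n → S, (∀ j, p j ≤ k (a j)) ∧ w = k (g a)} ≤ openBelow θ ι k c := by
  by_contra hcon
  obtain ⟨b, hb1, hb2⟩ := h.sat.exists_lower (ι := ι) (OrderHomClass.mono ι)
    (fun j => {a | p j ≤ k a})
    (fun j => infClosedTop_le k (p j)) (fun t A => ¬ f A ≤ c t)
    (fun t A B hAB hA hB => hA ((hf hAB).trans hB)) (fun a ha => by
      rw [Ultrafilter.eventually_not]
      intro hev
      have hev' : (θ fun _ => ι (g a)) ≤ θ c :=
        (h.rep.le_iff _ _).2 (by simpa only [hfg] using hev)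
      have hle : k (g a) ≤ openBelow θ ι k c := le_sSup ⟨g a, hev', rfl⟩
      exact hcon (le_trans (sInf_le ⟨a, ha, rfl⟩) hle))
  rw [Ultrafilter.eventually_not] at hb2
  exact hb2 ((h.rep.le_iff _ _).1 (hb b fun j a ha => (h.rep.le_iff _ _).2 (hb1 j a ha)))

lemma lowerApprox_le_iff (h : CanSetup U θ ι k) {x : C} {c : T → N} :
    lowerApprox θ ι k x ≤ θ c ↔ x ≤ openBelow θ ι k c := by
  constructor
  · intro hx
    refine h.dense.le_of_forall_closed fun p hp hpx => ?_
    have := h.le_openBelow_of_forall (c := c) (p := fun _ : Fin 1 => p)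
      (f := fun A => A 0) (fun A B hAB => hAB 0) (g := fun a => a 0) (fun a => rfl) (fun b hb =>
        (le_sSup ⟨b 0, rfl, p, hp, hpx, hb 0⟩ : θ (b 0) ≤ lowerApprox θ ι k x).trans hx)
    refine le_trans (le_sInf ?_) this
    rintro _ ⟨a, ha, rfl⟩
    exact ha 0
  · intro hx
    refine sSup_le ?_
    rintro _ ⟨b, rfl, p, hp, hpx, hb⟩
    obtain ⟨a, ha, hac⟩ := h.exists_of_le_openBelow hp (hpx.trans hx)
    exact (hb a ha).trans hac

lemma le_upperApprox_iff (h : CanSetup U θ ι k) {x : C} {b : T → N} :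
    θ b ≤ upperApprox θ ι k x ↔ closedAbove θ ι k b ≤ x :=
  h.dual.lowerApprox_le_iff

lemma lowerApprox_mono {x y : C} (hxy : x ≤ y) : lowerApprox θ ι k x ≤ lowerApprox θ ι k y := by
  refine sSup_le_sSup ?_
  rintro _ ⟨b, rfl, p, hp, hpx, hb⟩
  exact ⟨b, rfl, p, hp, hpx.trans hxy, hb⟩

lemma upperApprox_mono {x y : C} (hxy : x ≤ y) : upperApprox θ ι k x ≤ upperApprox θ ι k y := by
  refine sInf_le_sInf ?_
  rintro _ ⟨b, rfl, p, hp, hpx, hb⟩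
  exact ⟨b, rfl, p, hp, hxy.trans hpx, hb⟩

lemma lowerApprox_sup_le (h : CanSetup U θ ι k) (x y : C) :
    lowerApprox θ ι k (x ⊔ y) ≤ lowerApprox θ ι k x ⊔ lowerApprox θ ι k y := by
  refine h.rep.meet_dense _ _ fun c hc => ?_
  rw [sup_le_iff, h.lowerApprox_le_iff, h.lowerApprox_le_iff] at hc
  exact h.lowerApprox_le_iff.2 (sup_le hc.1 hc.2)

lemma le_upperApprox_inf (h : CanSetup U θ ι k) (x y : C) :
    upperApprox θ ι k x ⊓ upperApprox θ ι k y ≤ upperApprox θ ι k (x ⊓ y) :=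
  h.dual.lowerApprox_sup_le x y

lemma lowerApprox_bot (h : CanSetup U θ ι k) : lowerApprox θ ι k ⊥ = ⊥ :=
  le_bot_iff.1 (h.rep.meet_dense _ _ fun _ _ => h.lowerApprox_le_iff.2 bot_le)

lemma upperApprox_top (h : CanSetup U θ ι k) : upperApprox θ ι k ⊤ = ⊤ :=
  h.dual.lowerApprox_bot

lemma lowerApprox_le_upperApprox (h : CanSetup U θ ι k) (x : C) :
    lowerApprox θ ι k x ≤ upperApprox θ ι k x := by
  refine le_sInf ?_
  rintro _ ⟨c, rfl, q, hq, hxq, hc⟩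
  refine h.lowerApprox_le_iff.2 (hxq.trans ?_)
  rw [hq.eq_sSup]
  exact sSup_le_sSup (Set.image_mono hc)

section Operations

variable {n : ℕ} {fM : (Fin n → M) → M} {fN : (Fin n → N) → N} {fS : (Fin n → S) → S}

lemma lowerApprox_lowerCanExt_le (h : CanSetup U θ ι k) (hM : Monotone fM) (hN : Monotone fN)
    (hθ : ∀ b : Fin n → T → N, fM (fun j => θ (b j)) = θ fun t => fN fun j => b j t)
    (hι : ∀ a : Fin n → S, fN (fun j => ι (a j)) = ι (fS a)) (x : Fin n → C) :
    lowerApprox θ ι k (lowerCanExt k fS x) ≤ fM fun j => lowerApprox θ ι k (x j) := by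
  refine h.rep.meet_dense _ _ fun c hc => h.lowerApprox_le_iff.2 (sSup_le ?_)
  rintro _ ⟨p, hp, hpx, rfl⟩
  refine h.le_openBelow_of_forall hN hι fun b hb => ?_
  rw [← hθ]
  exact (hM fun j => (le_sSup ⟨b j, rfl, p j, hp j, hpx j, hb j⟩ :
    θ (b j) ≤ lowerApprox θ ι k (x j))).trans hc

lemma apply_upperApprox_le (h : CanSetup U θ ι k) (hM : CompleteNormalOp fM)
    (hθ : ∀ b : Fin n → T → N, fM (fun j => θ (b j)) = θ fun t => fN fun j => b j t)
    (hι : ∀ a : Fin n → S, fN (fun j => ι (a j)) = ι (fS a))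
    (hS : ∀ a a' : Fin n → S, (∀ j, k (a j) ≤ k (a' j)) → k (fS a) ≤ k (fS a'))
    (x : Fin n → C) :
    (fM fun j => upperApprox θ ι k (x j)) ≤ upperApprox θ ι k (lowerCanExt k fS x) := by
  have hx : ∀ j, upperApprox θ ι k (x j) ≤ sSup {m | ∃ b, m = θ b ∧ closedAbove θ ι k b ≤ x j} :=
    fun j => h.rep.join_dense _ _ fun b hb => le_sSup ⟨b, rfl, h.le_upperApprox_iff.1 hb⟩
  refine (hM.monotone hx).trans (hM.apply_sSup_le _ _ fun B hB => ?_)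
  choose b hb hbx using hB
  rw [show B = fun j => θ (b j) from funext hb, hθ, h.le_upperApprox_iff]
  refine le_trans ?_ (le_sSup ⟨fun j => closedAbove θ ι k (b j),
    fun j => closedElt_sInf_image _ _, hbx, rfl⟩)
  refine le_sInf ?_
  rintro _ ⟨a, ha, rfl⟩
  have h1 : ∀ j, ∃ a', k a' ≤ k (a j) ∧ θ (b j) ≤ θ fun _ => ι a' := fun j =>
    h.exists_of_closedAbove_le ⟨{k (a j)}, by simp, by simp⟩ (ha j)
  choose a' ha' hba' using h1
  refine le_trans (sInf_le ⟨fS a', ?_, rfl⟩) (hS a' a ha')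
  have h2 := hM.monotone hba'
  rw [hθ, hθ] at h2
  simp only [hι] at h2
  exact h2

lemma le_upperApprox_upperCanExt (h : CanSetup U θ ι k) (hM : Monotone fM) (hN : Monotone fN)
    (hθ : ∀ b : Fin n → T → N, fM (fun j => θ (b j)) = θ fun t => fN fun j => b j t)
    (hι : ∀ a : Fin n → S, fN (fun j => ι (a j)) = ι (fS a)) (x : Fin n → C) :
    (fM fun j => upperApprox θ ι k (x j)) ≤ upperApprox θ ι k (upperCanExt k fS x) :=
  lowerApprox_lowerCanExt_le (S := Sᵒᵈ) (C := Cᵒᵈ) (N := Nᵒᵈ) (M := Mᵒᵈ) h.dual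
    (fM := fM) (fN := fN) (fS := fS)
    (fun _ _ hxy => hM hxy) (fun _ _ hxy => hN hxy) hθ hι x

lemma lowerApprox_upperCanExt_le (h : CanSetup U θ ι k) (hM : CompleteNormalDualOp fM)
    (hθ : ∀ b : Fin n → T → N, fM (fun j => θ (b j)) = θ fun t => fN fun j => b j t)
    (hι : ∀ a : Fin n → S, fN (fun j => ι (a j)) = ι (fS a))
    (hS : ∀ a a' : Fin n → S, (∀ j, k (a j) ≤ k (a' j)) → k (fS a) ≤ k (fS a'))
    (x : Fin n → C) :
    lowerApprox θ ι k (upperCanExt k fS x) ≤ fM fun j => lowerApprox θ ι k (x j) :=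
  apply_upperApprox_le (S := Sᵒᵈ) (C := Cᵒᵈ) (N := Nᵒᵈ) (M := Mᵒᵈ) h.dual
    (fM := fM) (fN := fN) (fS := fS)
    hM.dual hθ hι (fun a a' h => hS a' a h) x

end Operations

/-- Separation: two disjoint ends of `S` that are separated in `N` are separated in `M`. -/
lemma not_lowerApprox_le (h : CanSetup U θ ι k) {x y p q : C}
    (hp : ClosedElt (Set.range k) p) (hq : OpenElt (Set.range k) q) (hpx : p ≤ x) (hyq : y ≤ q)
    (hsep : ∀ a a', p ≤ k a → k a' ≤ q → ¬ ι a ≤ ι a') :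
    ¬ lowerApprox θ ι k x ≤ upperApprox θ ι k y := by
  classical
  obtain ⟨σ, -, hσ⟩ := h.sat (fun _ => Set.univ) (fun _ _ _ => le_rfl) (fun _ => Filter.univ_mem)
  let m : T → S := fun t => ((σ t).filter fun r => p ≤ k r.1).inf Prod.fst
  let m' : T → S := fun t => ((σ t).filter fun r => k r.1 ≤ q).sup Prod.fst
  intro hle
  have hb : θ (fun t => ι (m t)) ≤ lowerApprox θ ι k x := by
    refine le_sSup ⟨_, rfl, p, hp, hpx, fun a ha => (h.rep.le_iff _ _).2 ?_⟩
    filter_upwards [hσ (a, 0)] with t ht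
    exact OrderHomClass.mono ι (Finset.inf_le (f := Prod.fst) (b := (a, 0)) (by simp [ht, ha]))
  have hc : upperApprox θ ι k y ≤ θ (fun t => ι (m' t)) := by
    refine sInf_le ⟨_, rfl, q, hq, hyq, fun a ha => (h.rep.le_iff _ _).2 ?_⟩
    filter_upwards [hσ (a, 0)] with t ht
    exact OrderHomClass.mono ι (Finset.le_sup (f := Prod.fst) (b := (a, 0)) (by simp [ht, ha]))
  obtain ⟨t, ht⟩ := ((h.rep.le_iff _ _).1 (hb.trans (hle.trans hc))).exists
  refine hsep _ _ ?_ ?_ ht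
  · exact Finset.inf_induction (p := fun a => p ≤ k a) (infClosedTop_le k p).1
      (infClosedTop_le k p).2 fun r hr => (Finset.mem_filter.1 hr).2
  · exact Finset.sup_induction (p := fun a => k a ≤ q) (supClosedBot_le k q).1
      (supClosedBot_le k q).2 fun r hr => (Finset.mem_filter.1 hr).2

end CanSetup

end Extension

lemma lowerCanExt_comp {B S C : Type} [CompleteLattice C] {n : ℕ} {η : B → C} {h : S → B}
    (hh : Function.Surjective h) {gB : (Fin n → B) → B} {gS : (Fin n → S) → S}
    (hg : ∀ a, h (gS a) = gB fun j => h (a j)) (x : Fin n → C) :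
    lowerCanExt η gB x = lowerCanExt (fun a => η (h a)) gS x := by
  have hr : Set.range (fun a => η (h a)) = Set.range η := hh.range_comp η
  have hw : ∀ p : Fin n → C, {w | ∃ a : Fin n → B, (∀ j, p j ≤ η (a j)) ∧ w = η (gB a)} =
      {w | ∃ a : Fin n → S, (∀ j, p j ≤ η (h (a j))) ∧ w = η (h (gS a))} := by
    intro p
    ext w
    constructor
    · rintro ⟨a, ha, rfl⟩
      choose a' ha' using fun j => hh (a j)
      obtain rfl : (fun j => h (a' j)) = a := funext ha'
      exact ⟨a', ha, by rw [hg]⟩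
    · rintro ⟨a, ha, rfl⟩
      exact ⟨_, ha, by rw [hg]⟩
  simp only [lowerCanExt, hr, hw]

lemma upperCanExt_comp {B S C : Type} [CompleteLattice C] {n : ℕ} {η : B → C} {h : S → B}
    (hh : Function.Surjective h) {gB : (Fin n → B) → B} {gS : (Fin n → S) → S}
    (hg : ∀ a, h (gS a) = gB fun j => h (a j)) (x : Fin n → C) :
    upperCanExt η gB x = upperCanExt (fun a => η (h a)) gS x :=
  lowerCanExt_comp (C := Cᵒᵈ) hh hg x

end PaperCore

/-! ### Stable set lattices of ultraproducts -/

namespace PaperCore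

section Ultraproduct

variable {L : FirstOrder.Language} {I : Type} {U : Ultrafilter I}

lemma pmk_surjective (U : Ultrafilter I) (M : I → Type) : Function.Surjective (pmk U (M := M)) :=
  Quotient.mk''_surjective

lemma relMap_pmk {M : I → Type} [∀ i, L.Structure (M i)] {n : ℕ} (r : L.Relations n)
    (x : Fin n → ∀ i, M i) :
    RelMap r (fun j => pmk U (x j)) ↔ ∀ᶠ i in U, RelMap r fun j => x j i :=
  relMap_quotient_mk' (s := (U : Filter I).productSetoid M)
    (ps := Ultraproduct.setoidPrestructure M U) r x

lemma pmk_mem_pX {M : I → Type} [∀ i, L.Structure (M i)] (Xb : L.Relations 1) (f : ∀ i, M i) :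
    pmk U f ∈ pX Xb ((U : Filter I).Product M) ↔ ∀ᶠ i in U, f i ∈ pX Xb (M i) := by
  have h := relMap_pmk (U := U) Xb ![f]
  have e1 : (fun j => pmk U (![f] j)) = ![pmk U f] := by
    funext j; fin_cases j; rfl
  have e2 : ∀ i, (fun j => (![f] : Fin 1 → ∀ i, M i) j i) = ![f i] := fun i => by
    funext j; fin_cases j; rfl
  simp only [e1, e2] at h
  exact h

lemma pR_pmk {M : I → Type} [∀ i, L.Structure (M i)] (Rb : L.Relations 2) (f g : ∀ i, M i) :
    pR Rb (pmk U f) (pmk U g) ↔ ∀ᶠ i in U, pR Rb (f i) (g i) := by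
  have h := relMap_pmk (U := U) Rb ![f, g]
  have e1 : (fun j => pmk U (![f, g] j)) = ![pmk U f, pmk U g] := by
    funext j; fin_cases j <;> rfl
  have e2 : ∀ i, (fun j => (![f, g] : Fin 2 → ∀ i, M i) j i) = ![f i, g i] := fun i => by
    funext j; fin_cases j <;> rfl
  simp only [e1, e2] at h
  exact h

lemma withParams_thetaSetP {M : I → Type} [∀ i, L.Structure (M i)] {n : ℕ}
    (A : Fin n → ∀ i, Set (M i)) :
    withParams (L := L) (fun j => thetaSetP U (A j)) =
      (letI : ∀ i, (L.sum (unaryLang n)).Structure (M i) := fun i => withParams fun j => A j i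
       (inferInstance : (L.sum (unaryLang n)).Structure ((U : Filter I).Product M))) := by
  refine Structure.ext ?_ ?_
  · funext m f x
    obtain f | f := f
    · rfl
    · exact f.elim
  · funext m r x
    choose y hy using fun j => pmk_surjective U M (x j)
    obtain rfl : (fun j => pmk U (y j)) = x := funext hy
    have h := @relMap_pmk _ _ U M (fun i => withParams fun j => A j i) m r y
    refine Eq.trans ?_ (propext h).symm
    obtain r | r := r
    · exact propext (relMap_pmk (U := U) (L := L) r y)
    · match m, r with
      | 1, r => rfl

lemma defOp_thetaSetP {M : I → Type} [∀ i, L.Structure (M i)] [∀ i, Nonempty (M i)]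
    (Xb : L.Relations 1) {n : ℕ} (φ : (L.sum (unaryLang n)).Formula (Fin 1))
    (A : Fin n → ∀ i, Set (M i)) :
    defOp Xb φ (fun j => thetaSetP U (A j)) = thetaSetP U fun i => defOp Xb φ fun j => A j i := by
  ext x
  obtain ⟨f, rfl⟩ := pmk_surjective U M x
  rw [mem_thetaSetP]
  change (_ ∧ _) ↔ ∀ᶠ i in (U : Filter I), (_ ∧ _)
  rw [Filter.eventually_and]
  refine and_congr (pmk_mem_pX Xb f) ?_
  rw [withParams_thetaSetP]
  let _ : ∀ i, (L.sum (unaryLang n)).Structure (M i) := fun i => withParams fun j => A j i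
  exact Ultraproduct.realize_formula_cast φ fun _ => f

variable {M : I → Type} [∀ i, L.Structure (M i)] [∀ i, Nonempty (M i)]
  (Xb Yb : L.Relations 1) (Rb : L.Relations 2)

lemma pmk_mem_rhoS_thetaSetP (A : ∀ i, Set (M i)) (g : ∀ i, M i) :
    pmk U g ∈ rhoS (pX Yb ((U : Filter I).Product M)) (pR Rb) (thetaSetP U A) ↔
      ∀ᶠ i in U, g i ∈ rhoS (pX Yb (M i)) (pR Rb) (A i) := by
  classical
  constructor
  · rintro ⟨h1, h2⟩
    have h3 : ∀ᶠ i in U, ∀ x ∈ A i, pR Rb x (g i) := by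
      by_contra hcon
      rw [← Ultrafilter.eventually_not] at hcon
      let f : ∀ i, M i := fun i =>
        Classical.epsilon fun x => x ∈ A i ∧ ¬ pR Rb x (g i)
      have hf : ∀ᶠ i in U, f i ∈ A i ∧ ¬ pR Rb (f i) (g i) := by
        filter_upwards [hcon] with i hi
        push Not at hi
        exact Classical.epsilon_spec (p := fun x => x ∈ A i ∧ ¬ pR Rb x (g i)) hi
      have h4 := (pR_pmk Rb f g).1 (h2 _ ((mem_thetaSetP U A f).2 (hf.mono fun i hi => hi.1)))
      obtain ⟨i, hi, hi'⟩ := (hf.and h4).exists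
      exact hi.2 hi'
    filter_upwards [(pmk_mem_pX Yb g).1 h1, h3] with i h1 h2 using ⟨h1, h2⟩
  · intro h
    refine ⟨(pmk_mem_pX Yb g).2 (h.mono fun i hi => hi.1), fun x hx => ?_⟩
    obtain ⟨f, rfl⟩ := pmk_surjective U M x
    refine (pR_pmk Rb f g).2 ?_
    filter_upwards [h, (mem_thetaSetP U A f).1 hx] with i h1 h2 using h1.2 _ h2

lemma isStableS_thetaSetP {A : ∀ i, Set (M i)}
    (hA : ∀ i, IsStableS (pX Xb (M i)) (pX Yb (M i)) (pR Rb) (A i)) :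
    IsStableS (pX Xb ((U : Filter I).Product M)) (pX Yb ((U : Filter I).Product M)) (pR Rb)
      (thetaSetP U A) := by
  constructor
  · intro x hx
    obtain ⟨f, rfl⟩ := pmk_surjective U M x
    exact (pmk_mem_pX Xb f).2 (Filter.mem_of_superset hx fun i hi => (hA i).1 hi)
  · intro x hx
    obtain ⟨f, rfl⟩ := pmk_surjective U M x
    by_contra hcon
    have hcon' : ∀ᶠ i in U, f i ∉ A i := Ultrafilter.eventually_not.2 hcon
    let g : ∀ i, M i := fun i =>
      Classical.epsilon fun y => y ∈ rhoS (pX Yb (M i)) (pR Rb) (A i) ∧ ¬ pR Rb (f i) y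
    have hg : ∀ᶠ i in U, g i ∈ rhoS (pX Yb (M i)) (pR Rb) (A i) ∧ ¬ pR Rb (f i) (g i) := by
      filter_upwards [hcon', (pmk_mem_pX Xb f).1 hx.1] with i hi hi'
      refine Classical.epsilon_spec
        (p := fun y => y ∈ rhoS (pX Yb (M i)) (pR Rb) (A i) ∧ ¬ pR Rb (f i) y) ?_
      by_contra hno
      push Not at hno
      exact hi ((hA i).2 ⟨hi', hno⟩)
    have h1 := (pR_pmk Rb f g).1 (hx.2 _ ((pmk_mem_rhoS_thetaSetP Yb Rb A g).2
      (hg.mono fun i hi => hi.1)))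
    obtain ⟨i, hi, hi'⟩ := (hg.and h1).exists
    exact hi.2 hi'

/-- The stable set of an ultraproduct determined by a family of stable sets. -/
def thetaStab (U : Ultrafilter I) (A : ∀ i, StabFO Xb Yb Rb (M i)) :
    StabFO Xb Yb Rb ((U : Filter I).Product M) :=
  ⟨thetaSetP U fun i => (A i).1, isStableS_thetaSetP Xb Yb Rb fun i => (A i).2⟩

lemma isStableS_lamS {Z : Type} [L.Structure Z] {B : Set Z} (hB : B ⊆ pX Yb Z) :
    IsStableS (pX Xb Z) (pX Yb Z) (pR Rb) (lamS (pX Xb Z) (pR Rb) B) :=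
  ⟨fun _ hx => hx.1, fun _ hx => ⟨hx.1, fun y hy => hx.2 y ⟨hB hy, fun _ hz => hz.2 y hy⟩⟩⟩

lemma ultraRep_thetaStab (U : Ultrafilter I) :
    UltraRep U (thetaStab (M := M) Xb Yb Rb U) where
  le_iff A B := by
    classical
    constructor
    · intro h
      by_contra hcon
      rw [← Ultrafilter.eventually_not] at hcon
      let f : ∀ i, M i := fun i => Classical.epsilon fun x => x ∈ (A i).1 ∧ x ∉ (B i).1
      have hf : ∀ᶠ i in U, f i ∈ (A i).1 ∧ f i ∉ (B i).1 := by
        filter_upwards [hcon] with i hi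
        exact Classical.epsilon_spec (p := fun x => x ∈ (A i).1 ∧ x ∉ (B i).1)
          (Set.not_subset.1 hi)
      have h1 : ∀ᶠ i in U, f i ∈ (B i).1 :=
        h (show pmk U f ∈ thetaSetP U _ from hf.mono fun i hi => hi.1)
      obtain ⟨i, hi, hi'⟩ := (hf.and h1).exists
      exact hi.2 hi'
    · intro h x hx
      obtain ⟨f, rfl⟩ := pmk_surjective U M x
      have hx' : ∀ᶠ i in U, f i ∈ (A i).1 := hx
      exact (show ∀ᶠ i in U, f i ∈ (B i).1 by
        filter_upwards [h, hx'] with i h1 h2 using h1 h2)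
  join_dense m m' h := by
    intro x hx
    obtain ⟨f, rfl⟩ := pmk_surjective U M x
    have hf := (pmk_mem_pX Xb f).1 (m.2.1 hx)
    let A : ∀ i, StabFO Xb Yb Rb (M i) := fun i =>
      ⟨lamS (pX Xb (M i)) (pR Rb) (rhoS (pX Yb (M i)) (pR Rb) {f i}),
        isStableS_lamS Xb Yb Rb fun _ hy => hy.1⟩
    refine h A ?_ (show ∀ᶠ i in U, f i ∈ (A i).1 from
      hf.mono fun i hi => ⟨hi, fun y hy => hy.2 _ rfl⟩)
    refine fun z hz => m.2.2 ⟨(thetaStab Xb Yb Rb U A).2.1 hz, fun y hy => ?_⟩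
    obtain ⟨e, rfl⟩ := pmk_surjective U M z
    obtain ⟨g, rfl⟩ := pmk_surjective U M y
    have hz' : ∀ᶠ i in U, e i ∈ (A i).1 := hz
    refine (pR_pmk Rb e g).2 ?_
    filter_upwards [hz', (pmk_mem_pX Yb g).1 hy.1, (pR_pmk Rb f g).1 (hy.2 _ hx)] with i h1 h2 h3
    exact h1.2 _ ⟨h2, by rintro _ rfl; exact h3⟩
  meet_dense m m' h := by
    intro x hx
    refine m'.2.2 ⟨m.2.1 hx, fun y hy => ?_⟩
    obtain ⟨f, rfl⟩ := pmk_surjective U M x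
    obtain ⟨g, rfl⟩ := pmk_surjective U M y
    have hg := (pmk_mem_pX Yb g).1 hy.1
    let A : ∀ i, StabFO Xb Yb Rb (M i) := fun i =>
      ⟨lamS (pX Xb (M i)) (pR Rb) ({g i} ∩ pX Yb (M i)),
        isStableS_lamS Xb Yb Rb Set.inter_subset_right⟩
    have h1 : ∀ᶠ i in U, f i ∈ (A i).1 := by
      refine h A (fun z hz => ?_) hx
      obtain ⟨e, rfl⟩ := pmk_surjective U M z
      refine (show ∀ᶠ i in U, e i ∈ (A i).1 from ?_)
      filter_upwards [(pmk_mem_pX Xb e).1 (m'.2.1 hz), (pR_pmk Rb e g).1 (hy.2 _ hz)] with i h1 h2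
      refine ⟨h1, ?_⟩
      rintro _ ⟨rfl, -⟩
      exact h2
    refine (pR_pmk Rb f g).2 ?_
    filter_upwards [h1, hg] with i h1 h2 using h1.2 _ ⟨rfl, h2⟩

end Ultraproduct

section DefinableOperations

variable {L : FirstOrder.Language} (Xb Yb : L.Relations 1) (Rb : L.Relations 2)
  {Ω : Type} {ar : Ω → ℕ} (Φf : ∀ f : Ω, (L.sum (unaryLang (ar f))).Formula (Fin 1))

lemma dOp_val {Z : Type} [L.Structure Z] (f : Ω) (As : Fin (ar f) → StabFO Xb Yb Rb Z)
    (h : IsStableS (pX Xb Z) (pX Yb Z) (pR Rb) (defOp Xb (Φf f) fun j => (As j).1)) :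
    (dOp Xb Yb Rb Φf Z f As).1 = defOp Xb (Φf f) fun j => (As j).1 := by
  exact congrArg Subtype.val (dif_pos h)

lemma dOp_thetaStab {I : Type} {U : Ultrafilter I} {M : I → Type} [∀ i, L.Structure (M i)]
    [∀ i, Nonempty (M i)] (f : Ω)
    (hclos : ∀ i, ∀ As : Fin (ar f) → StabFO Xb Yb Rb (M i),
      IsStableS (pX Xb (M i)) (pX Yb (M i)) (pR Rb) (defOp Xb (Φf f) fun j => (As j).1))
    (A : Fin (ar f) → ∀ i, StabFO Xb Yb Rb (M i)) :
    dOp Xb Yb Rb Φf ((U : Filter I).Product M) f (fun j => thetaStab Xb Yb Rb U (A j)) =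
      thetaStab Xb Yb Rb U fun i => dOp Xb Yb Rb Φf (M i) f fun j => A j i := by
  have h1 : thetaSetP U (fun i => defOp Xb (Φf f) fun j => (A j i).1) =
      (thetaStab Xb Yb Rb U fun i => dOp Xb Yb Rb Φf (M i) f fun j => A j i).1 := by
    refine congrArg (thetaSetP U) (funext fun i => ?_)
    exact (dOp_val Xb Yb Rb Φf f _ (hclos i _)).symm
  have h2 : defOp Xb (Φf f) (fun j => (thetaStab Xb Yb Rb U (A j)).1) =
      thetaSetP U (fun i => defOp Xb (Φf f) fun j => (A j i).1) :=
    defOp_thetaSetP Xb (Φf f) fun j i => (A j i).1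
  refine Subtype.ext ((dOp_val Xb Yb Rb Φf f _ ?_).trans (h2.trans h1))
  rw [h2]
  exact isStableS_thetaSetP Xb Yb Rb fun i => hclos i _

end DefinableOperations

end PaperCore

/-! ### Homomorphisms onto the canonical extension -/

namespace PaperCore

section Assembly

variable {Ω : Type} {ar : Ω → ℕ}

/-- A functional and total relation between an algebra and `B` that is compatible with all
operations exhibits `B` as a homomorphic image of a subalgebra. -/
lemma exists_omHomOnto {A B : OmLat Ω ar} (r : A.carrier → B.carrier → Prop)
    (huniq : ∀ d x y, r d x → r d y → x = y) (hsurj : ∀ x, ∃ d, r d x)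
    (hinf : ∀ d d' x x', r d x → r d' x' → r (d ⊓ d') (x ⊓ x'))
    (hsup : ∀ d d' x x', r d x → r d' x' → r (d ⊔ d') (x ⊔ x'))
    (htop : r ⊤ ⊤) (hbot : r ⊥ ⊥)
    (hops : ∀ f (as : Fin (ar f) → A.carrier) (xs : Fin (ar f) → B.carrier),
      (∀ j, r (as j) (xs j)) → r (A.ops f as) (B.ops f xs)) :
    ∃ (S : Set A.carrier) (hS : IsSubClosed A S), OmHomOnto A B S hS := by
  have hS : IsSubClosed A {d | ∃ x, r d x} := by
    refine ⟨?_, ?_, ⟨⊤, htop⟩, ⟨⊥, hbot⟩, fun f as has => ?_⟩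
    · rintro d ⟨x, hx⟩ d' ⟨x', hx'⟩
      exact ⟨_, hinf _ _ _ _ hx hx'⟩
    · rintro d ⟨x, hx⟩ d' ⟨x', hx'⟩
      exact ⟨_, hsup _ _ _ _ hx hx'⟩
    · choose xs hxs using has
      exact ⟨_, hops f as xs hxs⟩
  have hr : ∀ d : {d | ∃ x, r d x}, r d.1 d.2.choose := fun d => d.2.choose_spec
  refine ⟨_, hS, fun d => d.2.choose, fun x => ?_, fun d d' => ?_, fun d d' => ?_, ?_, ?_,
    fun f as => ?_⟩
  · obtain ⟨d, hd⟩ := hsurj x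
    exact ⟨⟨d, x, hd⟩, huniq _ _ _ (hr _) hd⟩
  · exact huniq _ _ _ (hr _) (hinf _ _ _ _ (hr d) (hr d'))
  · exact huniq _ _ _ (hr _) (hsup _ _ _ _ (hr d) (hr d'))
  · exact huniq _ _ _ (hr _) htop
  · exact huniq _ _ _ (hr _) hbot
  · exact huniq _ _ _ (hr _) (hops f _ _ fun j => hr (as j))

end Assembly

/-- If `p` is closed, `q` is open and `p ≰ q`, then some ultrafilter on the index set of a
subdirect representation keeps the filter of `p` away from the ideal of `q`. -/
lemma exists_ultrafilter_separating {J S C : Type} {N : J → Type} [∀ j, CompleteLattice (N j)]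
    [Lattice S] [BoundedOrder S] [CompleteLattice C] (e : BoundedLatticeHom S (∀ j, N j))
    (he : ∀ a a', e a ≤ e a' → a ≤ a') (k : BoundedLatticeHom S C) {p q : C} (hpq : ¬ p ≤ q) :
    ∃ V : Ultrafilter J, ∀ a a', p ≤ k a → k a' ≤ q → ¬ ∀ᶠ j in V, e a j ≤ e a' j := by
  let ρ : Type := {r : S × S // p ≤ k r.1 ∧ k r.2 ≤ q}
  let D : ρ → Set J := fun r => {j | ¬ e r.1.1 j ≤ e r.1.2 j}
  have hne : ∀ r, (D r).Nonempty := by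
    rintro ⟨⟨a, a'⟩, ha, ha'⟩
    by_contra hcon
    rw [Set.not_nonempty_iff_eq_empty, Set.eq_empty_iff_forall_notMem] at hcon
    have hle : a ≤ a' := he _ _ fun j => not_not.1 (hcon j)
    exact hpq (ha.trans ((OrderHomClass.mono k hle).trans ha'))
  have hdir : Directed (· ≥ ·) fun r : ρ => Filter.principal (D r) := by
    rintro ⟨⟨a, a'⟩, ha, ha'⟩ ⟨⟨b, b'⟩, hb, hb'⟩
    refine ⟨⟨(a ⊓ b, a' ⊔ b'), (infClosedTop_le k p).2 a ha b hb,
      (supClosedBot_le k q).2 a' ha' b' hb'⟩, ?_, ?_⟩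
    · refine Filter.principal_mono.2 fun j hj hle => hj ?_
      have h1 : e (a ⊓ b) j ≤ e a j := OrderHomClass.mono e inf_le_left j
      have h2 : e a' j ≤ e (a' ⊔ b') j := OrderHomClass.mono e le_sup_left j
      exact h1.trans (hle.trans h2)
    · refine Filter.principal_mono.2 fun j hj hle => hj ?_
      have h1 : e (a ⊓ b) j ≤ e b j := OrderHomClass.mono e inf_le_right j
      have h2 : e b' j ≤ e (a' ⊔ b') j := OrderHomClass.mono e le_sup_right j
      exact h1.trans (hle.trans h2)
  have : Nonempty ρ := ⟨⟨(⊤, ⊥), by simp⟩⟩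
  have hF : (⨅ r, Filter.principal (D r)).NeBot :=
    Filter.iInf_neBot_of_directed' hdir fun r => Filter.principal_neBot_iff.2 (hne r)
  refine ⟨Ultrafilter.of (⨅ r, Filter.principal (D r)), fun a a' ha ha' => ?_⟩
  rw [← Ultrafilter.eventually_not]
  exact Ultrafilter.of_le _ (Filter.mem_iInf_of_mem (⟨(a, a'), ha, ha'⟩ : ρ)
    (Filter.mem_principal_self _))

section Representation

variable {L : FirstOrder.Language} {Xb Yb : L.Relations 1} {Rb : L.Relations 2}
  {J S : Type} [Lattice S] [BoundedOrder S] {P : J → PolStruct L}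

/-- The homomorphism into the stable set lattice of an ultraproduct induced by a homomorphism
into a direct product. -/
def ultraHom (V : Ultrafilter J)
    (e : BoundedLatticeHom S (∀ j, StabFO Xb Yb Rb (P j).carrier)) :
    BoundedLatticeHom S (StabFO Xb Yb Rb (uProdStruct V P).carrier) where
  toFun a := thetaStab Xb Yb Rb V (e a)
  map_sup' a b := by
    rw [SupHomClass.map_sup]
    exact (ultraRep_thetaStab Xb Yb Rb V).map_sup _ _
  map_inf' a b := by
    rw [InfHomClass.map_inf]
    exact (ultraRep_thetaStab Xb Yb Rb V).map_inf _ _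
  map_top' := by
    rw [TopHomClass.map_top]
    exact (ultraRep_thetaStab Xb Yb Rb V).map_top
  map_bot' := by
    rw [BotHomClass.map_bot]
    exact (ultraRep_thetaStab Xb Yb Rb V).map_bot

open scoped Classical in
theorem canonicalExtension_mem_genVariety {Ω : Type} {ar : Ω → ℕ} (Lam Ups : Set Ω)
    (hcov : Lam ∪ Ups = Set.univ)
    (Φf : ∀ f : Ω, (L.sum (unaryLang (ar f))).Formula (Fin 1))
    (𝒮 : Set (PolStruct L))
    (hUclosed : ∀ (I : Type) (U : Ultrafilter I) (P : I → PolStruct L),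
      (∀ i, P i ∈ 𝒮) → uProdStruct U P ∈ 𝒮)
    (hclos : ∀ P ∈ 𝒮, ∀ (f : Ω) (As : Fin (ar f) → StabFO Xb Yb Rb P.carrier),
      IsStableS (pX Xb P.carrier) (pX Yb P.carrier) (pR Rb)
        (defOp Xb (Φf f) fun j => (As j).1))
    (hopL : ∀ P ∈ 𝒮, ∀ f ∈ Lam,
      CompleteNormalOp (fun As : Fin (ar f) → StabFO Xb Yb Rb P.carrier =>
        dOp Xb Yb Rb Φf P.carrier f As))
    (hopU : ∀ P ∈ 𝒮, ∀ f ∈ Ups,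
      CompleteNormalDualOp (fun As : Fin (ar f) → StabFO Xb Yb Rb P.carrier =>
        dOp Xb Yb Rb Φf P.carrier f As))
    (hP : ∀ j, P j ∈ 𝒮) (e : BoundedLatticeHom S (∀ j, StabFO Xb Yb Rb (P j).carrier))
    (he : ∀ a a', e a ≤ e a' → a ≤ a') (fS : ∀ f, (Fin (ar f) → S) → S)
    (hfS : ∀ f a j, e (fS f a) j = dOp Xb Yb Rb Φf (P j).carrier f fun i => e (a i) j)
    {C : Type} [CompleteLattice C] (k : BoundedLatticeHom S C)
    (hk : ∀ f (a a' : Fin (ar f) → S), (∀ j, k (a j) ≤ k (a' j)) → k (fS f a) ≤ k (fS f a'))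
    (hdense : DenseCompletion (Set.range k)) (hcompact : CompactCompletion (Set.range k)) :
    ({ carrier := C,
       ops := fun f x => if f ∈ Lam then lowerCanExt k (fS f) x
         else upperCanExt k (fS f) x } : OmLat Ω ar)
      ∈ genVariety (stableAlg Xb Yb Rb Φf '' 𝒮) := by
  have : Nonempty S := ⟨⊥⟩
  obtain ⟨T, U, hsat⟩ := GoodUltrafilter.exists_good (S × ℕ)
  let Q : Ultrafilter J → PolStruct L := fun V => uProdStruct V P
  have hQ : ∀ V, Q V ∈ 𝒮 := fun V => hUclosed J V P hP
  let K : Ultrafilter J → PolStruct L := fun V => uProdStruct U fun _ : T => Q V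
  have hK : ∀ V, K V ∈ 𝒮 := fun V => hUclosed T U _ fun _ => hQ V
  let θ : ∀ V, (T → StabFO Xb Yb Rb (Q V).carrier) → StabFO Xb Yb Rb (K V).carrier :=
    fun V => thetaStab Xb Yb Rb U
  let ι : ∀ V, BoundedLatticeHom S (StabFO Xb Yb Rb (Q V).carrier) := fun V => ultraHom V e
  have h : ∀ V, CanSetup U (θ V) (ι V) k := fun V =>
    ⟨hsat, ultraRep_thetaStab Xb Yb Rb U, hdense, hcompact⟩
  have hθ : ∀ V f (b : Fin (ar f) → T → StabFO Xb Yb Rb (Q V).carrier),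
      dOp Xb Yb Rb Φf (K V).carrier f (fun j => θ V (b j)) =
        θ V fun t => dOp Xb Yb Rb Φf (Q V).carrier f fun j => b j t := fun V f b =>
    dOp_thetaStab Xb Yb Rb Φf f (fun _ => hclos _ (hQ V) f) b
  have hι : ∀ V f (a : Fin (ar f) → S),
      dOp Xb Yb Rb Φf (Q V).carrier f (fun j => ι V (a j)) = ι V (fS f a) := fun V f a =>
    (dOp_thetaStab Xb Yb Rb Φf f (fun j => hclos _ (hP j) f) fun i => e (a i)).trans
      (congrArg (thetaStab Xb Yb Rb V) (funext fun j => (hfS f a j).symm))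
  have hsep : ∀ x y, (∀ V, lowerApprox (θ V) (ι V) k x ≤ upperApprox (θ V) (ι V) k y) →
      x ≤ y := by
    intro x y hxy
    refine hdense.le_of_forall_closed fun p hp hpx =>
      hdense.le_of_forall_open fun q hq hyq => ?_
    by_contra hpq
    obtain ⟨V, hV⟩ := exists_ultrafilter_separating e he k hpq
    exact (h V).not_lowerApprox_le hp hq hpx hyq (fun a a' ha ha' hle =>
      hV a a' ha ha' (((ultraRep_thetaStab Xb Yb Rb V).le_iff _ _).1 hle)) (hxy V)
  let r : (∀ V, StabFO Xb Yb Rb (K V).carrier) → C → Prop := fun d x =>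
    ∀ V, lowerApprox (θ V) (ι V) k x ≤ d V ∧ d V ≤ upperApprox (θ V) (ι V) k x
  refine ⟨Ultrafilter J, fun V => stableAlg Xb Yb Rb Φf (K V), fun V => ⟨_, hK V, rfl⟩,
    exists_omHomOnto r ?_ ?_ ?_ ?_ ?_ ?_ ?_⟩
  · intro d x y hx hy
    exact le_antisymm (hsep _ _ fun V => (hx V).1.trans (hy V).2)
      (hsep _ _ fun V => (hy V).1.trans (hx V).2)
  · exact fun x => ⟨(fun V => lowerApprox (θ V) (ι V) k x : ∀ V, StabFO Xb Yb Rb (K V).carrier),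
      fun V => ⟨le_rfl, (h V).lowerApprox_le_upperApprox x⟩⟩
  · intro d d' x x' hx hx' V
    exact ⟨le_inf ((CanSetup.lowerApprox_mono inf_le_left).trans (hx V).1)
        ((CanSetup.lowerApprox_mono inf_le_right).trans (hx' V).1),
      (inf_le_inf (hx V).2 (hx' V).2).trans ((h V).le_upperApprox_inf _ _)⟩
  · intro d d' x x' hx hx' V
    exact ⟨((h V).lowerApprox_sup_le _ _).trans (sup_le_sup (hx V).1 (hx' V).1),
      sup_le ((hx V).2.trans (CanSetup.upperApprox_mono le_sup_left))
        ((hx' V).2.trans (CanSetup.upperApprox_mono le_sup_right))⟩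
  · exact fun V => ⟨le_top, (h V).upperApprox_top.ge⟩
  · exact fun V => ⟨(h V).lowerApprox_bot.le, bot_le⟩
  · intro f as xs hr V
    have hlow : (fun j => lowerApprox (θ V) (ι V) k (xs j)) ≤ fun j => as j V :=
      fun j => (hr j V).1
    have hupp : (fun j => as j V) ≤ fun j => upperApprox (θ V) (ι V) k (xs j) :=
      fun j => (hr j V).2
    by_cases hf : f ∈ Lam
    · have hM := hopL _ (hK V) f hf
      have hN := hopL _ (hQ V) f hf
      simp only [hf, if_true]
      exact ⟨((h V).lowerApprox_lowerCanExt_le hM.monotone hN.monotone (hθ V f) (hι V f) xs).trans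
          (hM.monotone hlow),
        (hM.monotone hupp).trans ((h V).apply_upperApprox_le hM (hθ V f) (hι V f) (hk f) xs)⟩
    · have hf' : f ∈ Ups := (hcov.ge (Set.mem_univ f)).resolve_left hf
      have hM := hopU _ (hK V) f hf'
      have hN := hopU _ (hQ V) f hf'
      simp only [hf, if_false]
      exact ⟨((h V).lowerApprox_upperCanExt_le hM (hθ V f) (hι V f) (hk f) xs).trans
          (hM.monotone hlow),
        (hM.monotone hupp).trans
          ((h V).le_upperApprox_upperCanExt hM.monotone hN.monotone (hθ V f) (hι V f) xs)⟩

end Representation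

end PaperCore

open PaperCore in
open scoped Classical in
/-- main theorem of the paper: if `𝒮` is an ultraproducts-closed class of
polarity-based `𝓛*`-structures whose stable set lattices are closed under the operations
defined by the formulas `φ_f`, these being complete normal operators for `f ∈ Λ` and
complete normal dual operators for `f ∈ Υ`, then the variety generated by
`{P⁺_Ω : P ∈ 𝒮}` is closed under canonical extensions. -/
theorem statement5 {L : FirstOrder.Language} (Xb Yb : L.Relations 1) (Rb : L.Relations 2)
    {Ω : Type} {ar : Ω → ℕ} (Lam Ups : Set Ω) (hdisj : Disjoint Lam Ups)
    (hcov : Lam ∪ Ups = Set.univ)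
    (Φf : ∀ f : Ω, (L.sum (unaryLang (ar f))).Formula (Fin 1))
    (𝒮 : Set (PolStruct L))
    (hpol : ∀ P ∈ 𝒮, PolBased Xb Yb Rb P)
    (hUclosed : ∀ (I : Type) (U : Ultrafilter I) (P : I → PolStruct L),
      (∀ i, P i ∈ 𝒮) → uProdStruct U P ∈ 𝒮)
    (hclos : ∀ P ∈ 𝒮, ∀ (f : Ω) (As : Fin (ar f) → StabFO Xb Yb Rb P.carrier),
      IsStableS (pX Xb P.carrier) (pX Yb P.carrier) (pR Rb)
        (defOp Xb (Φf f) fun j => (As j).1))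
    (hopL : ∀ P ∈ 𝒮, ∀ f ∈ Lam,
      CompleteNormalOp (fun As : Fin (ar f) → StabFO Xb Yb Rb P.carrier =>
        dOp Xb Yb Rb Φf P.carrier f As))
    (hopU : ∀ P ∈ 𝒮, ∀ f ∈ Ups,
      CompleteNormalDualOp (fun As : Fin (ar f) → StabFO Xb Yb Rb P.carrier =>
        dOp Xb Yb Rb Φf P.carrier f As))
    (B : OmLat Ω ar) (hB : B ∈ genVariety (stableAlg Xb Yb Rb Φf '' 𝒮))
    (C : Type) [CompleteLattice C] (η : BoundedLatticeHom B.carrier C)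
    (hinj : Function.Injective η)
    (hdense : DenseCompletion (Set.range ⇑η))
    (hcompact : CompactCompletion (Set.range ⇑η)) :
    ({ carrier := C,
       ops := fun f x => if f ∈ Lam then lowerCanExt (⇑η) (B.ops f) x
         else upperCanExt (⇑η) (B.ops f) x } : OmLat Ω ar)
      ∈ genVariety (stableAlg Xb Yb Rb Φf '' 𝒮) := by
  obtain ⟨J, A, hA, W, hW, hom, hsurj, hinf, hsup, htop, hbot, hops⟩ := hB
  choose P hP hPA using hA
  obtain rfl : (fun j => stableAlg Xb Yb Rb Φf (P j)) = A := funext hPA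
  let W' : Sublattice (∀ j, StabFO Xb Yb Rb (P j).carrier) :=
    { carrier := W
      supClosed' := fun x hx y hy => hW.2.1 x hx y hy
      infClosed' := fun x hx y hy => hW.1 x hx y hy }
  let _ : BoundedOrder W' := Subtype.boundedOrder hW.2.2.2.1 hW.2.2.1
  let e : BoundedLatticeHom W' (∀ j, StabFO Xb Yb Rb (P j).carrier) :=
    { W'.subtype with
      map_top' := rfl
      map_bot' := rfl }
  let hom' : BoundedLatticeHom W' B.carrier :=
    { toFun := hom
      map_sup' := hsup
      map_inf' := hinf
      map_top' := htop
      map_bot' := hbot }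
  let fW : ∀ f, (Fin (ar f) → W') → W' := fun f a =>
    ⟨(prodAlg fun j => stableAlg Xb Yb Rb Φf (P j)).ops f fun i => (a i).1,
      hW.2.2.2.2 f _ fun i => (a i).2⟩
  have hfW : ∀ f a, hom' (fW f a) = B.ops f fun i => hom' (a i) := hops
  have hmono : ∀ f, Monotone (fW f) := by
    intro f a a' haa' j
    rcases hcov.ge (Set.mem_univ f) with hf | hf
    · exact (hopL _ (hP j) f hf).monotone fun i => haa' i j
    · exact (hopU _ (hP j) f hf).monotone fun i => haa' i j
  have hηle : ∀ x y, η x ≤ η y → x ≤ y := fun x y hxy =>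
    inf_eq_left.1 (hinj (by rw [InfHomClass.map_inf, inf_eq_left.2 hxy]))
  have hrange : Set.range (η.comp hom') = Set.range η := by
    rw [BoundedLatticeHom.coe_comp]
    exact hsurj.range_comp η
  have key := canonicalExtension_mem_genVariety Lam Ups hcov Φf 𝒮 hUclosed hclos hopL hopU hP e
    (fun _ _ haa' => haa') fW (fun _ _ _ => rfl) (η.comp hom') (fun f a a' haa' => ?_)
    (hrange.symm ▸ hdense) (hrange.symm ▸ hcompact)
  · have hE : (fun (f : Ω) (x : Fin (ar f) → C) =>
        if f ∈ Lam then lowerCanExt η (B.ops f) x else upperCanExt η (B.ops f) x) =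
        fun f x => if f ∈ Lam then lowerCanExt (η.comp hom') (fW f) x
          else upperCanExt (η.comp hom') (fW f) x := by
      funext f x
      split_ifs
      · exact lowerCanExt_comp hsurj (hfW f) x
      · exact upperCanExt_comp hsurj (hfW f) x
    rw [hE]
    exact key
  · have h1 : ∀ i, hom' (a i ⊓ a' i) = hom' (a i) := fun i => by
      rw [InfHomClass.map_inf]
      exact inf_eq_left.2 (hηle _ _ (haa' i))
    have h2 : hom' (fW f a) = hom' (fW f fun i => a i ⊓ a' i) := by
      simp only [hfW, h1]
    have h3 : fW f (fun i => a i ⊓ a' i) ≤ fW f a' := hmono f fun i => inf_le_right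
    exact OrderHomClass.mono η (h2.le.trans (OrderHomClass.mono hom' h3))
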